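/- Let M > 0 and suppose r ≤ 𝓡((λ_c + λ₀)/2). For every ε > 0 there exists r'(ε, M, ω₀) > r_c such that the second component of every solution of problem P^M_r with r ∈ (r_c, r'] satisfies sup_{x∈ℝ} |η(x) − d₊(r)| < ε. -/

import Mathlib

noncomputable section
open MeasureTheory Set Filter Topology

namespace BL

/-- Ω(τ) = ∫₀^τ ω(t) dt. -/
def Om (ω : ℝ → ℝ) (τ : ℝ) : ℝ := ∫ t in (0:ℝ)..τ, ω t

/-- ω₀ = max of |ω| on [0,1]. -/
def om0 (ω : ℝ → ℝ) : ℝ := sSup ((fun t => |ω t|) '' Icc (0:ℝ) 1)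

/-- λ₀ = √(2 max_{[0,1]} Ω). -/
def lam0 (ω : ℝ → ℝ) : ℝ := Real.sqrt (2 * sSup (Om ω '' Icc (0:ℝ) 1))

/-- H_p(p; λ) = (λ² − 2Ω(p))^{-1/2}. -/
def Hp (ω : ℝ → ℝ) (lam p : ℝ) : ℝ := (Real.sqrt (lam ^ 2 - 2 * Om ω p))⁻¹

/-- H(p, λ) = ∫₀^p (λ² − 2Ω(τ))^{-1/2} dτ (the stream solution in hodograph variables). -/
def Hs (ω : ℝ → ℝ) (lam p : ℝ) : ℝ := ∫ τ in (0:ℝ)..p, Hp ω lam τ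

/-- the depth d(λ). -/
def dep (ω : ℝ → ℝ) (lam : ℝ) : ℝ := Hs ω lam 1

/-- 𝓡(λ) = (λ² − 2Ω(1) + 2 d(λ))/3. -/
def RR (ω : ℝ → ℝ) (lam : ℝ) : ℝ := (lam ^ 2 - 2 * Om ω 1 + 2 * dep ω lam) / 3

/-- λ_c is the unique minimiser of 𝓡 on (λ₀, ∞) and r_c = 𝓡(λ_c) the critical value. -/
structure Crit (ω : ℝ → ℝ) (lamc rc : ℝ) : Prop where
  lt : lam0 ω < lamc
  isMin : ∀ lam, lam0 ω < lam → RR ω lamc ≤ RR ω lam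
  uniq : ∀ lam, lam0 ω < lam → RR ω lam = RR ω lamc → lam = lamc
  val : rc = RR ω lamc

/-- The fluid domain D = {0 < y < η(x)}. -/
def dom (η : ℝ → ℝ) : Set (ℝ × ℝ) := {z : ℝ × ℝ | 0 < z.2 ∧ z.2 < η z.1}

/-- Its closure D̄ = {0 ≤ y ≤ η(x)}. -/
def domc (η : ℝ → ℝ) : Set (ℝ × ℝ) := {z : ℝ × ℝ | 0 ≤ z.2 ∧ z.2 ≤ η z.1}

/-- ψ_x (partial derivative within D̄). -/
def px (η : ℝ → ℝ) (ψ : ℝ × ℝ → ℝ) (z : ℝ × ℝ) : ℝ :=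
  fderivWithin ℝ ψ (domc η) z (1, 0)

/-- ψ_y (partial derivative within D̄). -/
def py (η : ℝ → ℝ) (ψ : ℝ × ℝ → ℝ) (z : ℝ × ℝ) : ℝ :=
  fderivWithin ℝ ψ (domc η) z (0, 1)

/-- A solution of problem P^M_r. -/
structure Sol (ω : ℝ → ℝ) (M r : ℝ) (ψ : ℝ × ℝ → ℝ) (η : ℝ → ℝ) : Prop where
  eta_pos : ∀ x, 0 < η x
  eta_lip : LipschitzWith (Real.toNNReal M) η
  smooth : ContDiffOn ℝ 1 ψ (domc η)
  bottom : ∀ x, ψ (x, 0) = 0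
  surface : ∀ x, ψ (x, η x) = 1
  bern : ∀ x, px η ψ (x, η x) ^ 2 + py η ψ (x, η x) ^ 2 + 2 * η x = 3 * r
  unidir : ∀ z ∈ domc η, 0 < py η ψ z
  weak : ∀ φ : ℝ × ℝ → ℝ, ContDiff ℝ (⊤ : ℕ∞) φ → HasCompactSupport φ →
      tsupport φ ⊆ dom η →
      (∫ z in dom η,
        (px η ψ z * fderiv ℝ φ z (1, 0) + py η ψ z * fderiv ℝ φ z (0, 1))) =
      ∫ z in dom η, ω (ψ z) * φ z

/-- Stream (shear-flow) solutions: η is constant and ψ depends only on y. -/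
def IsStream (ψ : ℝ × ℝ → ℝ) (η : ℝ → ℝ) : Prop :=
  (∃ c : ℝ, ∀ x, η x = c) ∧ ∃ u : ℝ → ℝ, ∀ z : ℝ × ℝ, ψ z = u z.2

/-- Stokes-wave solutions: periodic, a single crest per wavelength, symmetric about crests. -/
def IsStokes (ψ : ℝ × ℝ → ℝ) (η : ℝ → ℝ) : Prop :=
  ∃ L : ℝ, 0 < L ∧ (∀ x, η (x + L) = η x) ∧ (∀ z : ℝ × ℝ, ψ (z.1 + L, z.2) = ψ z) ∧
    ∃ xc : ℝ, (∀ x, η (xc + x) = η (xc - x)) ∧ (∀ x, η x ≤ η xc) ∧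
      StrictAntiOn η (Icc xc (xc + L / 2))

/-- Solitary-wave solutions: non-stream, symmetric about the line through the single
crest, asymptoting a stream solution at infinity. -/
def IsSolitary (ω : ℝ → ℝ) (M r : ℝ) (ψ : ℝ × ℝ → ℝ) (η : ℝ → ℝ) : Prop :=
  ¬ IsStream ψ η ∧
  (∃ xc : ℝ, (∀ x, η (xc + x) = η (xc - x)) ∧ ∀ x, η x ≤ η xc) ∧
  ∃ (u : ℝ → ℝ) (c : ℝ), Sol ω M r (fun z => u z.2) (fun _ => c) ∧
    Tendsto η atTop (𝓝 c) ∧ Tendsto η atBot (𝓝 c) ∧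
    ∀ y : ℝ, Tendsto (fun x => ψ (x, y)) atTop (𝓝 (u y)) ∧
      Tendsto (fun x => ψ (x, y)) atBot (𝓝 (u y))

/-- h is the partial hodograph transform of (ψ, η):  ψ(q, h(q,p)) = p. -/
def Hodo (ψ : ℝ × ℝ → ℝ) (η : ℝ → ℝ) (h : ℝ → ℝ → ℝ) : Prop :=
  ∀ q : ℝ, ∀ p ∈ Icc (0:ℝ) 1, 0 ≤ h q p ∧ h q p ≤ η q ∧ ψ (q, h q p) = p

/-- h_q. -/
def hQ (h : ℝ → ℝ → ℝ) (q p : ℝ) : ℝ := deriv (fun q' => h q' p) q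

/-- h_p. -/
def hP (h : ℝ → ℝ → ℝ) (q p : ℝ) : ℝ := deriv (fun p' => h q p') p

/-- The flow force invariant s(ψ, η) evaluated at the abscissa x. -/
def fForce (ω : ℝ → ℝ) (r : ℝ) (ψ : ℝ × ℝ → ℝ) (η : ℝ → ℝ) (x : ℝ) : ℝ :=
  (r + 2 / 3 * Om ω 1) * η x -
    1 / 3 * (η x ^ 2 -
      ∫ y in (0:ℝ)..η x,
        (py η ψ (x, y) ^ 2 - px η ψ (x, y) ^ 2 - 2 * Om ω (ψ (x, y))))

/-- The flow force of the stream solution with parameter λ. -/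
def sStream (ω : ℝ → ℝ) (r lam : ℝ) : ℝ :=
  (r + 2 / 3 * Om ω 1) * dep ω lam -
    1 / 3 * (dep ω lam ^ 2 -
      ∫ p in (0:ℝ)..1, ((Hp ω lam p)⁻¹ - 2 * Om ω p * Hp ω lam p))

/-- (μ, φ) is an eigenpair of the Sturm–Liouville problem
−(H_p^{−3} φ′)′ = μ H_p^{−1} φ, φ(0) = 0, φ′(1) = H_p³(1) φ(1). -/
def EigenPair (ω : ℝ → ℝ) (lam μ : ℝ) (φ φ' : ℝ → ℝ) : Prop :=
  (∃ p ∈ Icc (0:ℝ) 1, φ p ≠ 0) ∧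
  (∀ p ∈ Icc (0:ℝ) 1, HasDerivWithinAt φ (φ' p) (Icc (0:ℝ) 1) p) ∧
  (∀ p ∈ Icc (0:ℝ) 1,
    HasDerivWithinAt (fun t => (Hp ω lam t)⁻¹ ^ 3 * φ' t)
      (-(μ * (Hp ω lam p)⁻¹ * φ p)) (Icc (0:ℝ) 1) p) ∧
  φ 0 = 0 ∧ φ' 1 = Hp ω lam 1 ^ 3 * φ 1

def IsEigen (ω : ℝ → ℝ) (lam μ : ℝ) : Prop := ∃ φ φ', EigenPair ω lam μ φ φ'

/-- μ0 is the least eigenvalue, with eigenfunction φ0. -/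
def Ground (ω : ℝ → ℝ) (lam μ0 : ℝ) (φ0 φ0' : ℝ → ℝ) : Prop :=
  IsLeast {μ : ℝ | IsEigen ω lam μ} μ0 ∧ EigenPair ω lam μ0 φ0 φ0'

/-- Normalisation ∫₀¹ φ0² H_p^{-1} dp = 1. -/
def Normalized (ω : ℝ → ℝ) (lam : ℝ) (φ0 : ℝ → ℝ) : Prop :=
  (∫ p in (0:ℝ)..1, φ0 p ^ 2 * (Hp ω lam p)⁻¹) = 1

/-- Weighted norm squared ‖u‖²_{θ,q₀} for functions on ℝ. -/
def wn1 (θ q0 : ℝ) (u : ℝ → ℝ) : ℝ :=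
  ∫ q : ℝ, u q ^ 2 * Real.exp (-θ * |q - q0|)

/-- Weighted norm squared ‖u‖²_{θ,q₀} for functions on S = ℝ × (0,1). -/
def wn2 (θ q0 : ℝ) (u : ℝ → ℝ → ℝ) : ℝ :=
  ∫ q : ℝ, (∫ p in (0:ℝ)..1, u q p ^ 2) * Real.exp (-θ * |q - q0|)

/-- The closed strip S̄ = ℝ × [0,1]. -/
def Sbar : Set (ℝ × ℝ) := (univ : Set ℝ) ×ˢ Icc (0:ℝ) 1

/-- a bounds the C²(S̄)-norm of u. -/
def C2Bound (u : ℝ × ℝ → ℝ) (a : ℝ) : Prop :=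
  ∀ z ∈ Sbar, ∀ n : ℕ, n ≤ 2 → ‖iteratedFDerivWithin ℝ n u Sbar z‖ ≤ a

/-- a bounds the C¹(S̄)-norm of u. -/
def C1Bound (u : ℝ × ℝ → ℝ) (a : ℝ) : Prop :=
  ∀ z ∈ Sbar, ∀ n : ℕ, n ≤ 1 → ‖iteratedFDerivWithin ℝ n u Sbar z‖ ≤ a

/-- ξ₀(q) = ∫₀¹ ξ(q,p) φ₀(p) H_p^{-1}(p) dp, the fundamental-mode projection. -/
def xiProj (ω : ℝ → ℝ) (lam : ℝ) (φ0 : ℝ → ℝ) (ξ : ℝ → ℝ → ℝ) (q : ℝ) : ℝ :=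
  ∫ p in (0:ℝ)..1, ξ q p * φ0 p * (Hp ω lam p)⁻¹

/-- ζ₀(q) = ∫₀¹ ζ(q,p) φ₀(p) dp. -/
def zetaProj (φ0 : ℝ → ℝ) (ζ : ℝ → ℝ → ℝ) (q : ℝ) : ℝ :=
  ∫ p in (0:ℝ)..1, ζ q p * φ0 p

/-- A compactly supported `C¹` function can be approximated in `C¹` by smooth functions
supported near its support. -/
theorem exists_smooth_approx {f : ℝ × ℝ → ℝ} (hf : ContDiff ℝ 1 f) (hs : HasCompactSupport f)
    {δ : ℝ} (hδ : 0 < δ) :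
    ∃ g : ℝ × ℝ → ℝ, ContDiff ℝ (⊤ : ℕ∞) g ∧ tsupport g ⊆ Metric.cthickening δ (tsupport f) ∧
      (∀ a, |g a - f a| ≤ δ) ∧ ∀ a, ‖fderiv ℝ g a - fderiv ℝ f a‖ ≤ δ := by
  have hf' : Continuous (fderiv ℝ f) := hf.continuous_fderiv one_ne_zero
  obtain ⟨ε₁, hε₁, h₁⟩ := Metric.uniformContinuous_iff.mp
    (hs.uniformContinuous_of_continuous hf.continuous) δ hδ
  obtain ⟨ε₂, hε₂, h₂⟩ := Metric.uniformContinuous_iff.mp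
    ((hs.fderiv ℝ).uniformContinuous_of_continuous hf') δ hδ
  set ε := min δ (min ε₁ ε₂)
  have hε : 0 < ε := lt_min hδ (lt_min hε₁ hε₂)
  let ρ : ContDiffBump (0 : ℝ × ℝ) := ⟨ε / 2, ε, half_pos hε, half_lt_self hε⟩
  have hloc : LocallyIntegrable (ρ.normed volume) (volume : Measure (ℝ × ℝ)) :=
    ρ.continuous_normed.locallyIntegrable
  refine ⟨convolution (ρ.normed volume) f (ContinuousLinearMap.lsmul ℝ ℝ) volume, ?_, ?_, ?_, ?_⟩
  · exact ρ.hasCompactSupport_normed.contDiff_convolution_left _ ρ.contDiff_normed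
      hf.continuous.locallyIntegrable
  · refine closure_minimal ?_ Metric.isClosed_cthickening
    refine (support_convolution_subset _).trans ?_
    rintro _ ⟨x, hx, y, hy, rfl⟩
    rw [ρ.support_normed_eq] at hx
    refine Metric.mem_cthickening_of_dist_le _ y _ _ (subset_tsupport _ hy) ?_
    have : ‖x‖ < ε := by simpa using hx
    simpa [dist_eq_norm] using this.le.trans (min_le_left _ _)
  · intro a
    rw [← Real.dist_eq]
    refine ρ.dist_normed_convolution_le hf.continuous.aestronglyMeasurable fun x hx => ?_
    exact (h₁ (lt_of_lt_of_le hx ((min_le_right _ _).trans (min_le_left _ _)))).le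
  · intro a
    rw [← dist_eq_norm, (hs.hasFDerivAt_convolution_right
      (ContinuousLinearMap.lsmul ℝ ℝ) hloc hf a).fderiv]
    have : (ContinuousLinearMap.lsmul ℝ ℝ : ℝ →L[ℝ] ℝ →L[ℝ] ℝ).precompR (ℝ × ℝ) =
        ContinuousLinearMap.lsmul ℝ ℝ := by
      ext <;> simp
    rw [this]
    refine ρ.dist_normed_convolution_le hf'.aestronglyMeasurable fun x hx => ?_
    exact (h₂ (lt_of_lt_of_le hx ((min_le_right _ _).trans (min_le_right _ _)))).le

/-- The weak form of a divergence equation extends from smooth to `C¹` test functions. -/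
theorem weak_form_of_smooth {a b f : ℝ × ℝ → ℝ} (ha : Continuous a) (hb : Continuous b)
    (hf : Continuous f) {V : Set (ℝ × ℝ)} (hV : IsOpen V)
    (hw : ∀ φ : ℝ × ℝ → ℝ, ContDiff ℝ (⊤ : ℕ∞) φ → HasCompactSupport φ → tsupport φ ⊆ V →
      ∫ z, (a z * fderiv ℝ φ z (1, 0) + b z * fderiv ℝ φ z (0, 1) - f z * φ z) = 0)
    {φ : ℝ × ℝ → ℝ} (hφ : ContDiff ℝ 1 φ) (hs : HasCompactSupport φ) (hφV : tsupport φ ⊆ V) :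
    ∫ z, (a z * fderiv ℝ φ z (1, 0) + b z * fderiv ℝ φ z (0, 1) - f z * φ z) = 0 := by
  obtain ⟨δ₀, hδ₀, hδV⟩ := hs.isCompact.exists_cthickening_subset_open hV hφV
  set K := Metric.cthickening δ₀ (tsupport φ)
  have hK : IsCompact K := hs.isCompact.cthickening
  have hcont : ∀ g : ℝ × ℝ → ℝ, ContDiff ℝ 1 g →
      Continuous fun z => a z * fderiv ℝ g z (1, 0) + b z * fderiv ℝ g z (0, 1) - f z * g z := by
    intro g hg
    have h1 := hg.continuous_fderiv one_ne_zero
    have h2 := hg.continuous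
    fun_prop
  have hzero : ∀ g : ℝ × ℝ → ℝ, tsupport g ⊆ K → ∀ z ∉ K,
      a z * fderiv ℝ g z (1, 0) + b z * fderiv ℝ g z (0, 1) - f z * g z = 0 := by
    intro g hg z hz
    have h1 : z ∉ tsupport g := fun h => hz (hg h)
    have h2 : fderiv ℝ g z = 0 := by
      by_contra h
      exact h1 (support_fderiv_subset ℝ h)
    simp [h2, image_eq_zero_of_notMem_tsupport h1]
  have hφK : tsupport φ ⊆ K := Metric.self_subset_cthickening _
  set C := ∫ z in K, (|a z| + |b z| + |f z|)
  have key : ∀ δ : ℝ, 0 < δ → δ ≤ δ₀ →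
      |∫ z, (a z * fderiv ℝ φ z (1, 0) + b z * fderiv ℝ φ z (0, 1) - f z * φ z)| ≤ δ * C := by
    intro δ hδ hδδ
    obtain ⟨g, hg, hgs, hg0, hg1⟩ := exists_smooth_approx hφ hs hδ
    have hgK : tsupport g ⊆ K := hgs.trans (Metric.cthickening_mono hδδ _)
    have hgc : HasCompactSupport g := HasCompactSupport.of_support_subset_isCompact hK
      ((subset_tsupport _).trans hgK)
    have hgw := hw g hg hgc (hgK.trans hδV)
    have hg' : ContDiff ℝ 1 g := hg.of_le (by exact_mod_cast le_top)
    have hsub : ∫ z, (a z * fderiv ℝ φ z (1, 0) + b z * fderiv ℝ φ z (0, 1) - f z * φ z) =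
        (∫ z in K, (a z * fderiv ℝ φ z (1, 0) + b z * fderiv ℝ φ z (0, 1) - f z * φ z)) -
        ∫ z in K, (a z * fderiv ℝ g z (1, 0) + b z * fderiv ℝ g z (0, 1) - f z * g z) := by
      rw [setIntegral_eq_integral_of_forall_compl_eq_zero (hzero φ hφK),
        setIntegral_eq_integral_of_forall_compl_eq_zero (hzero g hgK), hgw, sub_zero]
    rw [hsub, ← integral_sub
      ((hcont φ hφ).continuousOn.integrableOn_compact hK)
      ((hcont g hg').continuousOn.integrableOn_compact hK), ← integral_const_mul]
    rw [← Real.norm_eq_abs]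
    refine norm_integral_le_of_norm_le (ContinuousOn.integrableOn_compact hK (by fun_prop))
      (Eventually.of_forall fun z => ?_)
    have e0 := hg0 z
    have e : ∀ v : ℝ × ℝ, ‖v‖ = 1 → |fderiv ℝ φ z v - fderiv ℝ g z v| ≤ δ := by
      intro v hv
      have := (fderiv ℝ g z - fderiv ℝ φ z).le_opNorm v
      rw [hv, mul_one] at this
      rw [abs_sub_comm]
      exact this.trans (hg1 z)
    have e1 := e (1, 0) (by simp)
    have e2 := e (0, 1) (by simp)
    rw [abs_sub_comm] at e0
    rw [Real.norm_eq_abs]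
    calc _ = |a z * (fderiv ℝ φ z (1, 0) - fderiv ℝ g z (1, 0)) +
          b z * (fderiv ℝ φ z (0, 1) - fderiv ℝ g z (0, 1)) - f z * (φ z - g z)| := by
            congr 1; ring
      _ ≤ |a z| * |fderiv ℝ φ z (1, 0) - fderiv ℝ g z (1, 0)| +
          |b z| * |fderiv ℝ φ z (0, 1) - fderiv ℝ g z (0, 1)| + |f z| * |φ z - g z| := by
            rw [← abs_mul, ← abs_mul, ← abs_mul]
            exact (abs_sub _ _).trans (add_le_add_left (abs_add_le _ _) _)
      _ ≤ |a z| * δ + |b z| * δ + |f z| * δ := by gcongr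
      _ = δ * (|a z| + |b z| + |f z|) := by ring
  have hC : 0 ≤ C := integral_nonneg fun z => by positivity
  rw [← abs_eq_zero]
  refine le_antisymm (le_of_forall_pos_le_add fun ε hε => ?_) (abs_nonneg _)
  refine (key (min δ₀ (ε / (C + 1))) (lt_min hδ₀ (by positivity)) (min_le_left _ _)).trans ?_
  rw [zero_add]
  calc min δ₀ (ε / (C + 1)) * C ≤ ε / (C + 1) * C := by gcongr; exact min_le_right _ _
    _ ≤ ε := by rw [div_mul_eq_mul_div, div_le_iff₀ (by positivity)]; nlinarith

theorem tendsto_vertical_quotient {f : ℝ × ℝ → ℝ} {z : ℝ × ℝ} (hf : DifferentiableAt ℝ f z) :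
    Tendsto (fun h : ℝ => h⁻¹ * (f (z + (0, h)) - f z)) (𝓝[>] 0) (𝓝 (fderiv ℝ f z (0, 1))) ∧
    Tendsto (fun h : ℝ => h⁻¹ * (f (z + (0, -h)) - f z)) (𝓝[>] 0)
      (𝓝 (-fderiv ℝ f z (0, 1))) := by
  constructor
  · have h := (hf.hasFDerivAt.hasLineDerivAt (0, 1)).tendsto_slope_zero_right
    simpa using h
  · have h := (hf.hasFDerivAt.hasLineDerivAt (0, -1)).tendsto_slope_zero_right
    have e : fderiv ℝ f z (0, -1) = -fderiv ℝ f z (0, 1) := by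
      rw [← map_neg]; simp
    simpa [e] using h

/-- The domain-variation (momentum) identity in the vertical direction for weak solutions
`u ∈ C¹` of `Δu + f = 0`. -/
theorem vertical_momentum_identity {u f : ℝ × ℝ → ℝ} (hu : ContDiff ℝ 1 u)
    (hus : HasCompactSupport u) (hf : Continuous f) (hfs : HasCompactSupport f)
    {V : Set (ℝ × ℝ)} (hV : IsOpen V)
    (hw : ∀ φ : ℝ × ℝ → ℝ, ContDiff ℝ 1 φ → HasCompactSupport φ → tsupport φ ⊆ V →
      ∫ z, (fderiv ℝ u z (1, 0) * fderiv ℝ φ z (1, 0) +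
        fderiv ℝ u z (0, 1) * fderiv ℝ φ z (0, 1) - f z * φ z) = 0)
    {ζ : ℝ × ℝ → ℝ} (hζ : ContDiff ℝ 1 ζ) (hs : HasCompactSupport ζ) (hζV : tsupport ζ ⊆ V) :
    ∫ z, (2 * fderiv ℝ u z (0, 1) * (fderiv ℝ u z (1, 0) * fderiv ℝ ζ z (1, 0) +
        fderiv ℝ u z (0, 1) * fderiv ℝ ζ z (0, 1)) -
      (fderiv ℝ u z (1, 0) ^ 2 + fderiv ℝ u z (0, 1) ^ 2) * fderiv ℝ ζ z (0, 1) -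
      2 * f z * ζ z * fderiv ℝ u z (0, 1)) = 0 := by
  obtain ⟨δ, hδ, hδV⟩ := hs.isCompact.exists_cthickening_subset_open hV hζV
  set K := Metric.cthickening δ (tsupport ζ) with hKdef
  have hK : IsCompact K := hs.isCompact.cthickening
  have hζK : tsupport ζ ⊆ K := Metric.self_subset_cthickening _
  have hu' := hu.continuous_fderiv one_ne_zero
  have hζ' := hζ.continuous_fderiv one_ne_zero
  have huc := hu.continuous
  have hζc := hζ.continuous
  have hud := hu.differentiable one_ne_zero
  have hζd := hζ.differentiable one_ne_zero
  set a : ℝ × ℝ → ℝ := fun z => fderiv ℝ u z (1, 0) with ha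
  set b : ℝ × ℝ → ℝ := fun z => fderiv ℝ u z (0, 1) with hb
  set α : ℝ × ℝ → ℝ := fun z => fderiv ℝ ζ z (1, 0) with hα
  set β : ℝ × ℝ → ℝ := fun z => fderiv ℝ ζ z (0, 1) with hβ
  have hac : Continuous a := by fun_prop
  have hbc : Continuous b := by fun_prop
  have hαc : Continuous α := by fun_prop
  have hβc : Continuous β := by fun_prop
  obtain ⟨Cu, hCu⟩ := hu.lipschitzWith_of_hasCompactSupport hus one_ne_zero
  obtain ⟨Cζ, hCζ⟩ := hζ.lipschitzWith_of_hasCompactSupport hs one_ne_zero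
  obtain ⟨Bf, hBf⟩ := hf.bounded_above_of_compact_support hfs
  obtain ⟨Bζ, hBζ⟩ := hζc.bounded_above_of_compact_support hs
  have dirbd : ∀ (g : ℝ × ℝ → ℝ) (C : NNReal), LipschitzWith C g → ∀ z v : ℝ × ℝ, ‖v‖ = 1 →
      |fderiv ℝ g z v| ≤ C := by
    intro g C hg z v hv
    have h1 := (fderiv ℝ g z).le_opNorm v
    rw [hv, mul_one] at h1
    exact h1.trans (norm_fderiv_le_of_lipschitz ℝ hg)
  have ha_bd : ∀ z, |a z| ≤ Cu := fun z => dirbd u Cu hCu z _ (by simp)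
  have hb_bd : ∀ z, |b z| ≤ Cu := fun z => dirbd u Cu hCu z _ (by simp)
  have hα_bd : ∀ z, |α z| ≤ Cζ := fun z => dirbd ζ Cζ hCζ z _ (by simp)
  have hβ_bd : ∀ z, |β z| ≤ Cζ := fun z => dirbd ζ Cζ hCζ z _ (by simp)
  set G : ℝ → ℝ × ℝ → ℝ := fun h z =>
    (ζ (z + (0, -h)) - ζ z) * (a z ^ 2 + b z ^ 2) +
    (u (z + (0, h)) - u z) * ((a (z + (0, h)) + a z) * α z + (b (z + (0, h)) + b z) * β z) -
    (f (z + (0, h)) + f z) * ζ z * (u (z + (0, h)) - u z) with hG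
  have hshift : ∀ h : ℝ, 0 < h → h ≤ δ → ∀ z ∉ K, z + (0, -h) ∉ tsupport ζ := by
    intro h hh hhδ z hz hz'
    refine hz (Metric.mem_cthickening_of_dist_le z _ _ _ hz' ?_)
    simpa [dist_eq_norm, abs_of_pos hh, hδ.le] using hhδ
  have hGzero : ∀ h : ℝ, 0 < h → h ≤ δ → ∫ z, G h z = 0 := by
    intro h hh hhδ
    set φ : ℝ × ℝ → ℝ := fun z => ζ z * (u (z + (0, h)) - u z) with hφ
    have hφ1 : ContDiff ℝ 1 φ := by fun_prop
    have hφs : tsupport φ ⊆ tsupport ζ := tsupport_mul_subset_left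
    have hφc : HasCompactSupport φ := hs.mul_right
    have hφd : ∀ z v, fderiv ℝ φ z v = fderiv ℝ ζ z v * (u (z + (0, h)) - u z) +
        ζ z * (fderiv ℝ u (z + (0, h)) v - fderiv ℝ u z v) := by
      intro z v
      have h1 : HasFDerivAt (fun z => u (z + (0, h)) - u z)
          (fderiv ℝ u (z + (0, h)) - fderiv ℝ u z) z := by
        refine HasFDerivAt.sub ?_ (hud z).hasFDerivAt
        exact (hasFDerivAt_comp_add_right (0, h)).2 (hud _).hasFDerivAt
      rw [hφ, ((hζd z).hasFDerivAt.fun_mul h1).fderiv]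
      simp
      ring
    have e1 := hw φ hφ1 hφc (hφs.trans hζV)
    set φ' : ℝ × ℝ → ℝ := fun z => φ (z + (0, -h)) with hφ'
    have hφ'd : ∀ z, fderiv ℝ φ' z = fderiv ℝ φ (z + (0, -h)) := fun z =>
      fderiv_comp_add_right _
    have hφ'K : tsupport φ' ⊆ K := by
      refine closure_minimal (fun z hz => ?_) Metric.isClosed_cthickening
      by_contra hzK
      exact hshift h hh hhδ z hzK (hφs (subset_tsupport _ hz))
    have hφ'c : HasCompactSupport φ' := HasCompactSupport.of_support_subset_isCompact hK
      ((subset_tsupport _).trans hφ'K)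
    have e2 := hw φ' (by fun_prop) hφ'c (hφ'K.trans hδV)
    rw [← integral_add_right_eq_self _ ((0, h) : ℝ × ℝ)] at e2
    have hback : ∀ z : ℝ × ℝ, z + (0, h) + (0, -h) = z := by
      intro z; ext <;> simp
    simp only [hφ'd, hback] at e2
    simp only [hφ', hback] at e2
    have c1 := hφ1.continuous_fderiv one_ne_zero
    have c2 := hφ1.continuous
    have i1 : Integrable fun z => a z * fderiv ℝ φ z (1, 0) + b z * fderiv ℝ φ z (0, 1)
        - f z * φ z := by
      refine Continuous.integrable_of_hasCompactSupport (by fun_prop) ?_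
      exact (((hφc.fderiv_apply ℝ _).mul_left).add ((hφc.fderiv_apply ℝ _).mul_left)).sub
        hφc.mul_left
    have i2 : Integrable fun z => a (z + (0, h)) * fderiv ℝ φ z (1, 0) +
        b (z + (0, h)) * fderiv ℝ φ z (0, 1) - f (z + (0, h)) * φ z := by
      refine Continuous.integrable_of_hasCompactSupport (by fun_prop) ?_
      exact (((hφc.fderiv_apply ℝ _).mul_left).add ((hφc.fderiv_apply ℝ _).mul_left)).sub
        hφc.mul_left
    have e3 := integral_add i1 i2
    rw [e1, e2, add_zero] at e3
    set N : ℝ × ℝ → ℝ := fun z => a z ^ 2 + b z ^ 2 with hN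
    have hNc : Continuous N := by fun_prop
    have hζs : HasCompactSupport fun z => ζ (z + (0, -h)) := by
      refine HasCompactSupport.of_support_subset_isCompact hK fun z hz => ?_
      by_contra hzK
      exact hshift h hh hhδ z hzK (subset_tsupport _ hz)
    have j1 : Integrable fun z => ζ (z + (0, -h)) * N z :=
      Continuous.integrable_of_hasCompactSupport (by fun_prop) hζs.mul_right
    have j2 : Integrable fun z => ζ z * N (z + (0, h)) :=
      Continuous.integrable_of_hasCompactSupport (by fun_prop) hs.mul_right
    have j3 : ∫ z, ζ (z + (0, -h)) * N z = ∫ z, ζ z * N (z + (0, h)) := by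
      rw [← integral_add_right_eq_self _ ((0, h) : ℝ × ℝ)]
      simp only [hback]
    have e4 : ∀ z, G h z = (a z * fderiv ℝ φ z (1, 0) + b z * fderiv ℝ φ z (0, 1) - f z * φ z +
        (a (z + (0, h)) * fderiv ℝ φ z (1, 0) +
        b (z + (0, h)) * fderiv ℝ φ z (0, 1) - f (z + (0, h)) * φ z)) +
        (ζ (z + (0, -h)) * N z - ζ z * N (z + (0, h))) := by
      intro z
      simp only [hφd]
      simp only [hG, hφ, hN, ha, hb, hα, hβ]
      ring
    have e5 := integral_sub j1 j2
    rw [j3, sub_self] at e5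
    rw [integral_congr_ae (Eventually.of_forall e4)]
    refine (integral_add (i1.add i2) (j1.sub j2)).trans ?_
    simp only [Pi.add_apply, Pi.sub_apply]
    rw [e3, e5, add_zero]
  have hlim : Tendsto (fun h : ℝ => ∫ z, h⁻¹ * G h z) (𝓝[>] 0) (𝓝 (∫ z,
      (2 * b z * (a z * α z + b z * β z) - (a z ^ 2 + b z ^ 2) * β z - 2 * f z * ζ z * b z))) := by
    have hev : ∀ᶠ h : ℝ in 𝓝[>] 0, 0 < h ∧ h ≤ δ := by
      filter_upwards [Ioc_mem_nhdsGT hδ] with h hh using hh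
    set C : ℝ := Cζ * (Cu ^ 2 + Cu ^ 2) + Cu * ((Cu + Cu) * Cζ + (Cu + Cu) * Cζ) +
      (Bf + Bf) * Bζ * Cu with hC
    refine tendsto_integral_filter_of_dominated_convergence (K.indicator fun _ => C)
      ?_ ?_ ?_ ?_
    · refine Eventually.of_forall fun h => Continuous.aestronglyMeasurable ?_
      fun_prop
    · filter_upwards [hev] with h hh
      refine Eventually.of_forall fun z => ?_
      by_cases hz : z ∈ K
      · rw [indicator_of_mem hz]
        have k1 : |ζ (z + (0, -h)) - ζ z| ≤ Cζ * h := by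
          have := hCζ.dist_le_mul (z + (0, -h)) z
          simpa [dist_eq_norm, abs_of_pos hh.1, hh.1.le] using this
        have k2 : |u (z + (0, h)) - u z| ≤ Cu * h := by
          have := hCu.dist_le_mul (z + (0, h)) z
          simpa [dist_eq_norm, abs_of_pos hh.1, hh.1.le] using this
        have k3 : |f (z + (0, h))| ≤ Bf := hBf _
        have k4 : |f z| ≤ Bf := hBf _
        have k5 : |ζ z| ≤ Bζ := hBζ _
        have n1 : 0 ≤ Bf := (abs_nonneg _).trans k4
        have n2 : 0 ≤ Bζ := (abs_nonneg _).trans k5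
        have hh1 := hh.1
        rw [norm_mul, norm_inv, Real.norm_eq_abs, Real.norm_eq_abs, abs_of_pos hh.1,
          inv_mul_le_iff₀ hh.1]
        have s1 : |(ζ (z + (0, -h)) - ζ z) * (a z ^ 2 + b z ^ 2)| ≤
            (Cζ * h) * (Cu ^ 2 + Cu ^ 2) := by
          rw [abs_mul, abs_of_nonneg (by positivity : 0 ≤ a z ^ 2 + b z ^ 2), ← sq_abs (a z),
            ← sq_abs (b z)]
          have := ha_bd z
          have := hb_bd z
          gcongr
        have s2 : |(u (z + (0, h)) - u z) *
            ((a (z + (0, h)) + a z) * α z + (b (z + (0, h)) + b z) * β z)| ≤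
            (Cu * h) * ((Cu + Cu) * Cζ + (Cu + Cu) * Cζ) := by
          rw [abs_mul]
          have q1 : |a (z + (0, h)) + a z| ≤ Cu + Cu :=
            (abs_add_le _ _).trans (add_le_add (ha_bd _) (ha_bd _))
          have q2 : |b (z + (0, h)) + b z| ≤ Cu + Cu :=
            (abs_add_le _ _).trans (add_le_add (hb_bd _) (hb_bd _))
          have q3 : |(a (z + (0, h)) + a z) * α z + (b (z + (0, h)) + b z) * β z| ≤
              (Cu + Cu) * Cζ + (Cu + Cu) * Cζ := by
            refine (abs_add_le _ _).trans ?_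
            rw [abs_mul, abs_mul]
            have := hα_bd z
            have := hβ_bd z
            gcongr
          gcongr
        have s3 : |(f (z + (0, h)) + f z) * ζ z * (u (z + (0, h)) - u z)| ≤
            (Bf + Bf) * Bζ * (Cu * h) := by
          rw [abs_mul, abs_mul]
          have q1 : |f (z + (0, h)) + f z| ≤ Bf + Bf :=
            (abs_add_le _ _).trans (add_le_add k3 k4)
          gcongr
        calc |G h z| ≤ (Cζ * h) * (Cu ^ 2 + Cu ^ 2) +
              (Cu * h) * ((Cu + Cu) * Cζ + (Cu + Cu) * Cζ) + (Bf + Bf) * Bζ * (Cu * h) :=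
              (abs_sub _ _).trans (add_le_add ((abs_add_le _ _).trans (add_le_add s1 s2)) s3)
          _ = h * C := by rw [hC]; ring
      · rw [indicator_of_notMem hz]
        have z1 : ζ z = 0 := image_eq_zero_of_notMem_tsupport fun h' => hz (hζK h')
        have z2 : ζ (z + (0, -h)) = 0 :=
          image_eq_zero_of_notMem_tsupport (hshift h hh.1 hh.2 z hz)
        have z3 : fderiv ℝ ζ z = 0 := by
          by_contra h'
          exact hz (hζK (support_fderiv_subset ℝ h'))
        simp [hG, hα, hβ, z1, z2, z3]
    · rw [integrable_indicator_iff hK.measurableSet]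
      exact integrableOn_const hK.measure_lt_top.ne
    · refine Eventually.of_forall fun z => ?_
      have t0 : Tendsto (fun h : ℝ => z + ((0 : ℝ), h)) (𝓝[>] 0) (𝓝 z) := by
        have : Continuous fun h : ℝ => z + ((0 : ℝ), h) := by fun_prop
        have h0 := this.tendsto 0
        have e0 : z + ((0 : ℝ), (0 : ℝ)) = z := by ext <;> simp
        rw [e0] at h0
        exact h0.mono_left nhdsWithin_le_nhds
      have ta := (hac.tendsto z).comp t0
      have tb := (hbc.tendsto z).comp t0
      have tf := (hf.tendsto z).comp t0
      have t1 := (tendsto_vertical_quotient (hud z)).1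
      have t2 := (tendsto_vertical_quotient (hζd z)).2
      have := ((t2.mul_const (a z ^ 2 + b z ^ 2)).add (t1.mul (((ta.add_const (a z)).mul_const
        (α z)).add ((tb.add_const (b z)).mul_const (β z))))).sub
        (((tf.add_const (f z)).mul_const (ζ z)).mul t1)
      refine (this.congr fun h => ?_).trans_eq ?_
      · simp only [hG, Function.comp]
        ring
      · congr 1
        simp only [hb, hβ]
        ring
  refine tendsto_nhds_unique hlim ((tendsto_const_nhds (x := (0 : ℝ))).congr' ?_)
  filter_upwards [Ioc_mem_nhdsGT hδ] with h hh
  rw [integral_const_mul, hGzero h hh.1 hh.2, mul_zero]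

theorem contDiff_of_contDiffAt_tsupport {f : ℝ × ℝ → ℝ} {n : WithTop ℕ∞}
    (hf : ∀ x ∈ tsupport f, ContDiffAt ℝ n f x) : ContDiff ℝ n f := by
  refine contDiff_iff_contDiffAt.2 fun x => ?_
  by_cases hx : x ∈ tsupport f
  · exact hf x hx
  · exact contDiffAt_const.congr_of_eventuallyEq (notMem_tsupport_iff_eventuallyEq.1 hx)

theorem isOpen_dom {η : ℝ → ℝ} (hη : Continuous η) : IsOpen (dom η) :=
  (isOpen_lt continuous_const continuous_snd).inter
    (isOpen_lt continuous_snd (hη.comp continuous_fst))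

theorem isClosed_domc {η : ℝ → ℝ} (hη : Continuous η) : IsClosed (domc η) :=
  (isClosed_le continuous_const continuous_snd).inter
    (isClosed_le continuous_snd (hη.comp continuous_fst))

theorem dom_subset_domc (η : ℝ → ℝ) : dom η ⊆ domc η := fun _ hz => ⟨hz.1.le, hz.2.le⟩

theorem isCompact_domc_strip {η : ℝ → ℝ} (hη : Continuous η) (a b : ℝ) :
    IsCompact {z : ℝ × ℝ | z ∈ domc η ∧ z.1 ∈ Icc a b} := by
  obtain ⟨C, hC⟩ := (isCompact_Icc (a := a) (b := b)).bddAbove_image hη.continuousOn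
  refine ((isCompact_Icc (a := a) (b := b)).prod
    (isCompact_Icc (a := (0:ℝ)) (b := C))).of_isClosed_subset
    ((isClosed_domc hη).inter (isClosed_Icc.preimage continuous_fst)) ?_
  rintro z ⟨hz, hz1⟩
  exact ⟨hz1, hz.1, hz.2.trans (hC (mem_image_of_mem _ hz1))⟩

namespace Sol

variable {ω : ℝ → ℝ} {M r : ℝ} {ψ : ℝ × ℝ → ℝ} {η : ℝ → ℝ}

theorem eta_continuous (h : Sol ω M r ψ η) : Continuous η := h.eta_lip.continuous

theorem uniqueDiffOn (h : Sol ω M r ψ η) : UniqueDiffOn ℝ (domc η) := by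
  intro z hz
  set m : ℝ := (Real.toNNReal M : ℝ) with hm
  have hm0 : 0 ≤ m := NNReal.coe_nonneg _
  let g : ℝ × ℝ → ℝ := fun w => w.2 + m * |w.1 - z.1|
  have hg : ConvexOn ℝ univ g := by
    refine ⟨convex_univ, ?_⟩
    intro p _ q _ a b ha hb hab
    have e : a * p.1 + b * q.1 - z.1 = a * (p.1 - z.1) + b * (q.1 - z.1) := by
      linear_combination z.1 * hab
    have h1 : |a * p.1 + b * q.1 - z.1| ≤ a * |p.1 - z.1| + b * |q.1 - z.1| := by
      rw [e]
      refine (abs_add_le _ _).trans ?_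
      rw [abs_mul, abs_mul, abs_of_nonneg ha, abs_of_nonneg hb]
    have := mul_le_mul_of_nonneg_left h1 hm0
    simp only [g, Prod.fst_add, Prod.snd_add, Prod.smul_fst, Prod.smul_snd, smul_eq_mul]
    linarith
  let C : Set (ℝ × ℝ) := {w | 0 ≤ w.2} ∩ {w | g w ≤ η z.1}
  have hC : Convex ℝ C := by
    refine Convex.inter ?_ ?_
    · exact (convex_Ici (0:ℝ)).linear_preimage (LinearMap.snd ℝ ℝ ℝ)
    · simpa using hg.convex_le (η z.1)
  have hgc : Continuous g := by fun_prop
  have hint : (interior C).Nonempty := by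
    refine ⟨(z.1, η z.1 / 2), mem_interior.2 ⟨{w | 0 < w.2} ∩ {w | g w < η z.1}, ?_, ?_, ?_⟩⟩
    · rintro w ⟨hw1, hw2⟩
      simp only [mem_ofPred_eq] at hw1 hw2
      exact ⟨by simpa using hw1.le, by simpa using hw2.le⟩
    · exact (isOpen_lt continuous_const continuous_snd).inter (isOpen_lt hgc continuous_const)
    · have := h.eta_pos z.1
      constructor
      · simp only [mem_ofPred_eq]; linarith
      · simp only [mem_ofPred_eq, g, sub_self, abs_zero]; linarith
  have hzC : z ∈ C := ⟨hz.1, by simpa [g] using hz.2⟩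
  refine (uniqueDiffWithinAt_convex hC hint (subset_closure hzC)).mono ?_
  intro w hw
  refine ⟨hw.1, ?_⟩
  have h2 : g w ≤ η z.1 := hw.2
  have h1 := h.eta_lip.dist_le_mul w.1 z.1
  rw [Real.dist_eq, Real.dist_eq, ← hm] at h1
  have h3 := neg_abs_le (η w.1 - η z.1)
  simp only [g] at h2
  linarith

theorem px_continuousOn (h : Sol ω M r ψ η) : ContinuousOn (px η ψ) (domc η) :=
  (h.smooth.continuousOn_fderivWithin h.uniqueDiffOn le_rfl).clm_apply continuousOn_const

theorem py_continuousOn (h : Sol ω M r ψ η) : ContinuousOn (py η ψ) (domc η) :=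
  (h.smooth.continuousOn_fderivWithin h.uniqueDiffOn le_rfl).clm_apply continuousOn_const

theorem continuousOn (h : Sol ω M r ψ η) : ContinuousOn ψ (domc η) := h.smooth.continuousOn

theorem domc_mem_nhds (h : Sol ω M r ψ η) {z : ℝ × ℝ} (hz : z ∈ dom η) : domc η ∈ 𝓝 z :=
  mem_of_superset ((isOpen_dom h.eta_continuous).mem_nhds hz) (dom_subset_domc η)

theorem contDiffAt (h : Sol ω M r ψ η) {z : ℝ × ℝ} (hz : z ∈ dom η) : ContDiffAt ℝ 1 ψ z :=
  h.smooth.contDiffAt (h.domc_mem_nhds hz)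

theorem fderiv_fst (h : Sol ω M r ψ η) {z : ℝ × ℝ} (hz : z ∈ dom η) :
    fderiv ℝ ψ z (1, 0) = px η ψ z := by
  rw [px, fderivWithin_of_mem_nhds (h.domc_mem_nhds hz)]

theorem fderiv_snd (h : Sol ω M r ψ η) {z : ℝ × ℝ} (hz : z ∈ dom η) :
    fderiv ℝ ψ z (0, 1) = py η ψ z := by
  rw [py, fderivWithin_of_mem_nhds (h.domc_mem_nhds hz)]

theorem hasDerivWithinAt_vertical (h : Sol ω M r ψ η) {x y : ℝ} (hy : y ∈ Icc 0 (η x)) :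
    HasDerivWithinAt (fun t => ψ (x, t)) (py η ψ (x, y)) (Icc 0 (η x)) y := by
  have h1 : HasFDerivWithinAt ψ (fderivWithin ℝ ψ (domc η) (x, y)) (domc η) (x, y) :=
    ((h.smooth.differentiableOn one_ne_zero) (x, y) hy).hasFDerivWithinAt
  have h2 : HasDerivWithinAt (fun t : ℝ => (x, t)) ((0 : ℝ), (1 : ℝ)) (Icc 0 (η x)) y :=
    ((hasDerivAt_const y x).prodMk (hasDerivAt_id y)).hasDerivWithinAt
  exact h1.comp_hasDerivWithinAt y h2 (fun t ht => ht)

theorem vertical_continuousOn (h : Sol ω M r ψ η) (x : ℝ) :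
    ContinuousOn (fun t => ψ (x, t)) (Icc 0 (η x)) :=
  fun _ hy => (h.hasDerivWithinAt_vertical hy).continuousWithinAt

theorem vertical_hasDerivAt (h : Sol ω M r ψ η) {x y : ℝ} (hy : y ∈ Ioo 0 (η x)) :
    HasDerivAt (fun t => ψ (x, t)) (py η ψ (x, y)) y :=
  (h.hasDerivWithinAt_vertical (Ioo_subset_Icc_self hy)).hasDerivAt (Icc_mem_nhds hy.1 hy.2)

theorem vertical_strictMonoOn (h : Sol ω M r ψ η) (x : ℝ) :
    StrictMonoOn (fun t => ψ (x, t)) (Icc 0 (η x)) := by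
  refine strictMonoOn_of_deriv_pos (convex_Icc _ _) (h.vertical_continuousOn x) ?_
  intro y hy
  rw [interior_Icc] at hy
  rw [(h.vertical_hasDerivAt hy).deriv]
  exact h.unidir _ (Ioo_subset_Icc_self hy)

theorem mem_Icc (h : Sol ω M r ψ η) {z : ℝ × ℝ} (hz : z ∈ domc η) : ψ z ∈ Icc (0:ℝ) 1 := by
  have h0 := (h.vertical_strictMonoOn z.1).monotoneOn (left_mem_Icc.2 (h.eta_pos z.1).le) hz hz.1
  have h1 := (h.vertical_strictMonoOn z.1).monotoneOn hz (right_mem_Icc.2 (h.eta_pos z.1).le) hz.2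
  simp only [h.bottom, h.surface] at h0 h1
  exact ⟨h0, h1⟩

theorem mem_Ioo (h : Sol ω M r ψ η) {z : ℝ × ℝ} (hz : z ∈ dom η) : ψ z ∈ Ioo (0:ℝ) 1 := by
  have hz' := dom_subset_domc η hz
  have h0 := (h.vertical_strictMonoOn z.1) (left_mem_Icc.2 (h.eta_pos z.1).le) hz' hz.1
  have h1 := (h.vertical_strictMonoOn z.1) hz' (right_mem_Icc.2 (h.eta_pos z.1).le) hz.2
  simp only [h.bottom, h.surface] at h0 h1
  exact ⟨h0, h1⟩

theorem mem_dom_of_mem_Ioo (h : Sol ω M r ψ η) {z : ℝ × ℝ} (hz : z ∈ domc η)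
    (hψ : ψ z ∈ Ioo (0:ℝ) 1) : z ∈ dom η := by
  refine ⟨lt_of_le_of_ne hz.1 ?_, lt_of_le_of_ne hz.2 ?_⟩
  · intro e
    have : z = (z.1, 0) := Prod.ext rfl e.symm
    rw [this, h.bottom] at hψ
    exact lt_irrefl _ hψ.1
  · intro e
    have : z = (z.1, η z.1) := Prod.ext rfl e
    rw [this, h.surface] at hψ
    exact lt_irrefl _ hψ.2

theorem eta_lt (h : Sol ω M r ψ η) (x : ℝ) : η x < 3 / 2 * r := by
  have h1 := h.bern x
  have h2 := h.unidir (x, η x) ⟨(h.eta_pos x).le, le_rfl⟩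
  nlinarith [sq_nonneg (px η ψ (x, η x)), pow_pos h2 2]

theorem omega_continuousOn (h : Sol ω M r ψ η) (hω : ContinuousOn ω (Icc 0 1)) :
    ContinuousOn (fun z => ω (ψ z)) (domc η) :=
  hω.comp h.continuousOn fun _ hz => h.mem_Icc hz

theorem momentum (h : Sol ω M r ψ η) (hω : ContinuousOn ω (Icc 0 1)) {ζ : ℝ × ℝ → ℝ}
    (hζ : ContDiff ℝ 1 ζ) (hs : HasCompactSupport ζ) (hζd : tsupport ζ ⊆ dom η) :
    ∫ z, (2 * py η ψ z * (px η ψ z * fderiv ℝ ζ z (1, 0) + py η ψ z * fderiv ℝ ζ z (0, 1))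
      - (px η ψ z ^ 2 + py η ψ z ^ 2) * fderiv ℝ ζ z (0, 1)
      - 2 * ω (ψ z) * ζ z * py η ψ z) = 0 := by
  have hdo := isOpen_dom h.eta_continuous
  obtain ⟨K', hK', hK1, hK2⟩ := exists_compact_between hs hdo hζd
  obtain ⟨κ, hκ1, hκ0, -⟩ := exists_contMDiffMap_one_nhds_of_subset_interior
    (n := ⊤) (modelWithCornersSelf ℝ (ℝ × ℝ)) (isClosed_tsupport ζ) hK1
  have hκ : ContDiff ℝ (⊤ : ℕ∞) (κ : ℝ × ℝ → ℝ) := κ.contMDiff.contDiff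
  have hκs : tsupport (κ : ℝ × ℝ → ℝ) ⊆ K' := by
    refine closure_minimal ?_ hK'.isClosed
    intro z hz
    by_contra hzK
    exact hz (hκ0 z hzK)
  obtain ⟨V₀, hV₀, hζV₀, hV₀κ⟩ := mem_nhdsSet_iff_exists.1 hκ1
  let V := V₀ ∩ dom η
  have hV : IsOpen V := hV₀.inter hdo
  have hζV : tsupport ζ ⊆ V := subset_inter hζV₀ hζd
  let u : ℝ × ℝ → ℝ := fun z => κ z * ψ z
  let f : ℝ × ℝ → ℝ := fun z => κ z * ω (ψ z)
  have hus' : tsupport u ⊆ tsupport (κ : ℝ × ℝ → ℝ) := tsupport_mul_subset_left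
  have hfs' : tsupport f ⊆ tsupport (κ : ℝ × ℝ → ℝ) := tsupport_mul_subset_left
  have hus : HasCompactSupport u := hK'.of_isClosed_subset (isClosed_tsupport _) (hus'.trans hκs)
  have hfs : HasCompactSupport f := hK'.of_isClosed_subset (isClosed_tsupport _) (hfs'.trans hκs)
  have hu : ContDiff ℝ 1 u := by
    refine contDiff_of_contDiffAt_tsupport fun z hz => ?_
    have hzd : z ∈ dom η := hK2 (hκs (hus' hz))
    exact ((hκ.of_le (by exact_mod_cast le_top)).contDiffAt).mul (h.contDiffAt hzd)
  have hf : Continuous f := by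
    refine continuous_of_tsupport fun z hz => ?_
    have hzd : z ∈ dom η := hK2 (hκs (hfs' hz))
    exact hκ.continuous.continuousAt.mul
      ((h.omega_continuousOn hω).continuousAt (h.domc_mem_nhds hzd))
  have hκV : ∀ z ∈ V, κ z = 1 := fun z hz => hV₀κ hz.1
  have huV : ∀ z ∈ V, fderiv ℝ u z = fderiv ℝ ψ z := by
    intro z hz
    refine Filter.EventuallyEq.fderiv_eq ?_
    filter_upwards [hV.mem_nhds hz] with w hw
    simp [u, hκV w hw]
  have hux : ∀ z ∈ V, fderiv ℝ u z (1, 0) = px η ψ z := fun z hz => by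
    rw [huV z hz, h.fderiv_fst hz.2]
  have huy : ∀ z ∈ V, fderiv ℝ u z (0, 1) = py η ψ z := fun z hz => by
    rw [huV z hz, h.fderiv_snd hz.2]
  have hfV : ∀ z ∈ V, f z = ω (ψ z) := fun z hz => by simp [f, hκV z hz]
  have hcux : Continuous fun z => fderiv ℝ u z (1, 0) :=
    (hu.continuous_fderiv one_ne_zero).clm_apply continuous_const
  have hcuy : Continuous fun z => fderiv ℝ u z (0, 1) :=
    (hu.continuous_fderiv one_ne_zero).clm_apply continuous_const
  have hw : ∀ φ : ℝ × ℝ → ℝ, ContDiff ℝ 1 φ → HasCompactSupport φ → tsupport φ ⊆ V →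
      ∫ z, (fderiv ℝ u z (1, 0) * fderiv ℝ φ z (1, 0) + fderiv ℝ u z (0, 1) * fderiv ℝ φ z (0, 1)
        - f z * φ z) = 0 := by
    intro φ hφ hφs hφV
    refine weak_form_of_smooth hcux hcuy hf hV ?_ hφ hφs hφV
    intro φ hφ hφs hφV
    have hφc : Continuous (fderiv ℝ φ) := hφ.continuous_fderiv (by simp)
    have hd0 : ∀ z, z ∉ V → fderiv ℝ φ z = 0 := fun z hz =>
      image_eq_zero_of_notMem_tsupport fun hz' => hz (hφV (tsupport_fderiv_subset ℝ hz'))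
    have h0 : ∀ z, z ∉ V → φ z = 0 := fun z hz =>
      image_eq_zero_of_notMem_tsupport fun hz' => hz (hφV hz')
    have hI1 : Integrable fun z =>
        fderiv ℝ u z (1, 0) * fderiv ℝ φ z (1, 0) + fderiv ℝ u z (0, 1) * fderiv ℝ φ z (0, 1) := by
      refine Continuous.integrable_of_hasCompactSupport
        ((hcux.mul (hφc.clm_apply continuous_const)).add
          (hcuy.mul (hφc.clm_apply continuous_const))) ?_
      refine (hφs.fderiv ℝ).mono ?_
      intro z hz hz'
      exact hz (by simp [hz'])
    have hI2 : Integrable fun z => f z * φ z :=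
      (hf.mul hφ.continuous).integrable_of_hasCompactSupport hφs.mul_left
    rw [integral_sub hI1 hI2, sub_eq_zero]
    have hwk := h.weak φ hφ hφs (hφV.trans inter_subset_right)
    have e1 : (∫ z in dom η, (px η ψ z * fderiv ℝ φ z (1, 0) + py η ψ z * fderiv ℝ φ z (0, 1)))
        = ∫ z, (fderiv ℝ u z (1, 0) * fderiv ℝ φ z (1, 0)
          + fderiv ℝ u z (0, 1) * fderiv ℝ φ z (0, 1)) := by
      rw [setIntegral_eq_integral_of_forall_compl_eq_zero]
      · congr 1
        ext z
        by_cases hz : z ∈ V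
        · rw [hux z hz, huy z hz]
        · simp [hd0 z hz]
      · intro z hz
        simp [hd0 z fun hz' => hz hz'.2]
    have e2 : (∫ z in dom η, ω (ψ z) * φ z) = ∫ z, f z * φ z := by
      rw [setIntegral_eq_integral_of_forall_compl_eq_zero]
      · congr 1
        ext z
        by_cases hz : z ∈ V
        · rw [hfV z hz]
        · simp [h0 z hz]
      · intro z hz
        simp [h0 z fun hz' => hz hz'.2]
    rw [← e1, hwk, e2]
  refine Eq.trans ?_ (vertical_momentum_identity hu hus hf hfs hV hw hζ hs hζV)
  congr 1
  ext z
  by_cases hz : z ∈ V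
  · rw [hux z hz, huy z hz, hfV z hz]
  · have hd0 : fderiv ℝ ζ z = 0 :=
      image_eq_zero_of_notMem_tsupport fun hz' => hz (hζV (tsupport_fderiv_subset ℝ hz'))
    have h0 : ζ z = 0 := image_eq_zero_of_notMem_tsupport fun hz' => hz (hζV hz')
    simp [hd0, h0]

theorem momentum_levels (h : Sol ω M r ψ η) (hω : ContinuousOn ω (Icc 0 1)) {χ θ : ℝ → ℝ}
    (hχ : ContDiff ℝ 1 χ) {a b : ℝ} (hχs : ∀ x, x ∉ Icc a b → χ x = 0)
    (hθ : ContDiff ℝ 1 θ) {τ : ℝ} (hτ : 0 < τ) (hθs : ∀ p, p ∉ Icc τ (1 - τ) → θ p = 0) :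
    ∫ z in dom η, (2 * deriv χ z.1 * θ (ψ z) * px η ψ z * py η ψ z
      + χ z.1 * deriv θ (ψ z) * py η ψ z * (px η ψ z ^ 2 + py η ψ z ^ 2)
      - 2 * ω (ψ z) * χ z.1 * θ (ψ z) * py η ψ z) = 0 := by
  classical
  have hdo := isOpen_dom h.eta_continuous
  let ζ : ℝ × ℝ → ℝ := (dom η).indicator fun z => χ z.1 * θ (ψ z)
  let K : Set (ℝ × ℝ) := {z | (z ∈ domc η ∧ z.1 ∈ Icc a b)} ∩ ψ ⁻¹' (Icc τ (1 - τ))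
  have hstrip := isCompact_domc_strip h.eta_continuous a b
  have hK : IsCompact K := by
    have : ContinuousOn ψ {z | (z ∈ domc η ∧ z.1 ∈ Icc a b)} :=
      h.continuousOn.mono fun z hz => hz.1
    exact hstrip.of_isClosed_subset (this.preimage_isClosed_of_isClosed hstrip.isClosed
      isClosed_Icc) inter_subset_left
  have hKd : K ⊆ dom η := fun z hz => h.mem_dom_of_mem_Ioo hz.1.1
    ⟨hτ.trans_le hz.2.1, hz.2.2.trans_lt (by linarith)⟩
  have hζK : tsupport ζ ⊆ K := by
    refine closure_minimal ?_ hK.isClosed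
    intro z hz
    have hzd : z ∈ dom η := by
      by_contra hzd
      exact hz (indicator_of_notMem hzd _)
    have hz' : χ z.1 * θ (ψ z) ≠ 0 := by
      have := Function.mem_support.1 hz
      simpa only [ζ, indicator_of_mem hzd] using this
    refine ⟨⟨dom_subset_domc η hzd, ?_⟩, ?_⟩
    · by_contra hc
      exact hz' (by rw [hχs _ hc, zero_mul])
    · by_contra hc
      exact hz' (by rw [hθs _ hc, mul_zero])
  have hζe : ∀ z ∈ dom η, ζ =ᶠ[𝓝 z] fun w => χ w.1 * θ (ψ w) := by
    intro z hz
    filter_upwards [hdo.mem_nhds hz] with w hw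
    exact indicator_of_mem hw _
  have hζ : ContDiff ℝ 1 ζ := by
    refine contDiff_of_contDiffAt_tsupport fun z hz => ?_
    have hzd := hKd (hζK hz)
    refine ContDiffAt.congr_of_eventuallyEq ?_ (hζe z hzd)
    exact (hχ.contDiffAt.comp z contDiffAt_fst).mul (hθ.contDiffAt.comp z (h.contDiffAt hzd))
  have hs : HasCompactSupport ζ := hK.of_isClosed_subset (isClosed_tsupport _) hζK
  refine (Eq.trans ?_ (setIntegral_eq_integral_of_forall_compl_eq_zero (s := dom η)
    (μ := volume) ?_)).trans (h.momentum hω hζ hs (hζK.trans hKd))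
  · refine setIntegral_congr_fun hdo.measurableSet fun z hz => ?_
    have hψd : HasFDerivAt ψ (fderiv ℝ ψ z) z :=
      ((h.contDiffAt hz).differentiableAt one_ne_zero).hasFDerivAt
    have h1 : HasFDerivAt (fun w : ℝ × ℝ => χ w.1)
        (deriv χ z.1 • ContinuousLinearMap.fst ℝ ℝ ℝ) z :=
      ((hχ.differentiable one_ne_zero).differentiableAt.hasDerivAt).comp_hasFDerivAt z
        hasFDerivAt_fst
    have h2 : HasFDerivAt (fun w : ℝ × ℝ => θ (ψ w)) (deriv θ (ψ z) • fderiv ℝ ψ z) z :=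
      ((hθ.differentiable one_ne_zero).differentiableAt.hasDerivAt).comp_hasFDerivAt z hψd
    have h3 := ((hζe z hz).fderiv_eq).trans (h1.mul h2).fderiv
    have hv : ζ z = χ z.1 * θ (ψ z) := indicator_of_mem hz _
    simp only [h3, hv, add_apply, smul_apply,
      h.fderiv_fst hz, h.fderiv_snd hz, smul_eq_mul, ContinuousLinearMap.coe_fst']
    ring
  · intro z hz
    have hzt : z ∉ tsupport ζ := fun hz' => hz (hKd (hζK hz'))
    have hd0 : fderiv ℝ ζ z = 0 :=
      image_eq_zero_of_notMem_tsupport fun hz' => hzt (tsupport_fderiv_subset ℝ hz')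
    have h0 : ζ z = 0 := image_eq_zero_of_notMem_tsupport hzt
    simp [hd0, h0]

end Sol

theorem fubini_dom {η : ℝ → ℝ} (hη : Continuous η) (hpos : ∀ x, 0 < η x) {F : ℝ × ℝ → ℝ}
    (hF : ContinuousOn F (domc η)) {a b : ℝ} (h0 : ∀ z : ℝ × ℝ, z.1 ∉ Icc a b → F z = 0) :
    IntegrableOn F (dom η) ∧ Integrable (fun x => ∫ y in (0:ℝ)..η x, F (x, y)) ∧
      ∫ z in dom η, F z = ∫ x, ∫ y in (0:ℝ)..η x, F (x, y) := by
  have hdm : MeasurableSet (dom η) := (isOpen_dom hη).measurableSet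
  have hI : IntegrableOn F (dom η) := by
    have h1 : IntegrableOn F {z : ℝ × ℝ | z ∈ domc η ∧ z.1 ∈ Icc a b} :=
      (hF.mono fun z hz => hz.1).integrableOn_compact (isCompact_domc_strip hη a b)
    refine h1.of_forall_sdiff_eq_zero hdm fun z hz => h0 z fun hz1 => hz.2 ⟨dom_subset_domc η hz.1, hz1⟩
  have hI' : Integrable ((dom η).indicator F) (volume.prod volume) :=
    (integrable_indicator_iff hdm).2 hI
  have hslice : ∀ x, ∫ y, (dom η).indicator F (x, y) = ∫ y in (0:ℝ)..η x, F (x, y) := by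
    intro x
    rw [intervalIntegral.integral_of_le (hpos x).le, integral_Ioc_eq_integral_Ioo,
      ← integral_indicator measurableSet_Ioo]
    rfl
  refine ⟨hI, ?_, ?_⟩
  · simpa only [hslice] using hI'.integral_prod_left
  · rw [← integral_indicator hdm, Measure.volume_eq_prod, integral_prod _ hI']
    simp only [hslice]

namespace Sol

variable {ω : ℝ → ℝ} {M r : ℝ} {ψ : ℝ × ℝ → ℝ} {η : ℝ → ℝ}

theorem slice_continuousOn (h : Sol ω M r ψ η) {F : ℝ × ℝ → ℝ} (hF : ContinuousOn F (domc η))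
    (x : ℝ) : ContinuousOn (fun y => F (x, y)) (uIcc 0 (η x)) := by
  rw [uIcc_of_le (h.eta_pos x).le]
  exact hF.comp (by fun_prop) fun y hy => hy

theorem slice_intervalIntegrable (h : Sol ω M r ψ η) {F : ℝ × ℝ → ℝ}
    (hF : ContinuousOn F (domc η)) (x : ℝ) :
    IntervalIntegrable (fun y => F (x, y)) volume 0 (η x) :=
  (h.slice_continuousOn hF x).intervalIntegrable

theorem integral_comp_vertical (h : Sol ω M r ψ η) {g : ℝ → ℝ} (hg : ContinuousOn g (Icc 0 1))
    (x : ℝ) : ∫ y in (0:ℝ)..η x, g (ψ (x, y)) * py η ψ (x, y) = ∫ p in (0:ℝ)..1, g p := by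
  have hx := (h.eta_pos x).le
  have := intervalIntegral.integral_comp_mul_deriv'' (a := 0) (b := η x)
    (f := fun y => ψ (x, y)) (f' := fun y => py η ψ (x, y)) (g := g)
    (by rw [uIcc_of_le hx]; exact h.vertical_continuousOn x)
    (by
      intro y hy
      rw [min_eq_left hx, max_eq_right hx] at hy
      exact (h.vertical_hasDerivAt hy).hasDerivWithinAt)
    (h.slice_continuousOn h.py_continuousOn x)
    (by
      refine hg.mono ?_
      rintro _ ⟨y, hy, rfl⟩
      rw [uIcc_of_le hx] at hy
      exact h.mem_Icc hy)
  simpa only [h.bottom, h.surface, Function.comp_def] using this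

theorem layer_bound (h : Sol ω M r ψ η) {s : ℝ → ℝ} (hs : ContDiff ℝ 1 s) (hmono : Monotone s)
    (hs0 : s 0 = 0) (hs1 : s 1 = 1) {F : ℝ × ℝ → ℝ} (hF : ContinuousOn F (domc η)) {x c ε : ℝ}
    (hc : ∀ y ∈ Icc 0 (η x), deriv s (ψ (x, y)) ≠ 0 → |F (x, y) - c| ≤ ε) :
    |(∫ y in (0:ℝ)..η x, deriv s (ψ (x, y)) * py η ψ (x, y) * F (x, y)) - c| ≤ ε := by
  have hx := (h.eta_pos x).le
  have hds : Continuous (deriv s) := hs.continuous_deriv le_rfl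
  have hone : ∫ y in (0:ℝ)..η x, deriv s (ψ (x, y)) * py η ψ (x, y) = 1 := by
    rw [h.integral_comp_vertical hds.continuousOn, intervalIntegral.integral_deriv_eq_sub]
    · rw [hs0, hs1, sub_zero]
    · exact fun p _ => (hs.differentiable one_ne_zero) p
    · exact hds.intervalIntegrable _ _
  have hk : ContinuousOn (fun z => deriv s (ψ z) * py η ψ z) (domc η) :=
    (hds.comp_continuousOn h.continuousOn).mul h.py_continuousOn
  have e : (∫ y in (0:ℝ)..η x, deriv s (ψ (x, y)) * py η ψ (x, y) * F (x, y)) - c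
      = ∫ y in (0:ℝ)..η x, deriv s (ψ (x, y)) * py η ψ (x, y) * (F (x, y) - c) := by
    have e1 : c = ∫ y in (0:ℝ)..η x, deriv s (ψ (x, y)) * py η ψ (x, y) * c := by
      rw [intervalIntegral.integral_mul_const, hone, one_mul]
    conv_lhs => rw [e1]
    refine (intervalIntegral.integral_sub (h.slice_intervalIntegrable (hk.mul hF) x)
      (h.slice_intervalIntegrable (hk.mul continuousOn_const) x)).symm.trans ?_
    simp only [mul_sub, Pi.mul_apply]
  rw [e]
  calc |∫ y in (0:ℝ)..η x, deriv s (ψ (x, y)) * py η ψ (x, y) * (F (x, y) - c)|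
      ≤ ∫ y in (0:ℝ)..η x, |deriv s (ψ (x, y)) * py η ψ (x, y) * (F (x, y) - c)| :=
        intervalIntegral.abs_integral_le_integral_abs hx
    _ ≤ ∫ y in (0:ℝ)..η x, deriv s (ψ (x, y)) * py η ψ (x, y) * ε := by
        refine intervalIntegral.integral_mono_on hx
          (h.slice_intervalIntegrable (hk.mul (hF.sub continuousOn_const)).abs x)
          (h.slice_intervalIntegrable (hk.mul continuousOn_const) x) ?_
        intro y hy
        have h1 : 0 ≤ deriv s (ψ (x, y)) := hmono.deriv_nonneg
        have h2 : 0 < py η ψ (x, y) := h.unidir _ hy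
        rw [abs_mul, abs_of_nonneg (mul_nonneg h1 h2.le)]
        by_cases hd : deriv s (ψ (x, y)) = 0
        · simp [hd]
        · exact mul_le_mul_of_nonneg_left (hc y hy hd) (mul_nonneg h1 h2.le)
    _ = ε := by rw [intervalIntegral.integral_mul_const, hone, one_mul]

end Sol

/-- Smooth step rising from `0` to `1` on `[1 / n, 2 / n]`. -/
def stepLow (n : ℕ) (p : ℝ) : ℝ := Real.smoothTransition (n * p - 1)

/-- Smooth step rising from `0` to `1` on `[1 - 2 / n, 1 - 1 / n]`. -/
def stepHigh (n : ℕ) (p : ℝ) : ℝ := Real.smoothTransition (n * (p - 1) + 2)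

theorem smoothTransition_deriv_ne_zero {t : ℝ} (ht : deriv Real.smoothTransition t ≠ 0) :
    t ∈ Icc (0:ℝ) 1 := by
  by_contra hc
  refine ht ?_
  rcases not_and_or.1 hc with h | h
  · have : Real.smoothTransition =ᶠ[𝓝 t] fun _ => 0 := by
      filter_upwards [Iio_mem_nhds (not_le.1 h)] with s hs
      exact Real.smoothTransition.zero_of_nonpos (le_of_lt hs)
    rw [this.deriv_eq, deriv_const]
  · have : Real.smoothTransition =ᶠ[𝓝 t] fun _ => 1 := by
      filter_upwards [Ioi_mem_nhds (not_le.1 h)] with s hs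
      exact Real.smoothTransition.one_of_one_le (le_of_lt hs)
    rw [this.deriv_eq, deriv_const]

theorem stepLow_contDiff (n : ℕ) : ContDiff ℝ 1 (stepLow n) :=
  (Real.smoothTransition.contDiff (n := 1)).comp (by fun_prop)

theorem stepHigh_contDiff (n : ℕ) : ContDiff ℝ 1 (stepHigh n) :=
  (Real.smoothTransition.contDiff (n := 1)).comp (by fun_prop)

theorem stepLow_monotone (n : ℕ) : Monotone (stepLow n) := fun p q hpq =>
  Real.smoothTransition.monotone (by
    have := mul_le_mul_of_nonneg_left hpq (Nat.cast_nonneg (α := ℝ) n)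
    linarith)

theorem stepHigh_monotone (n : ℕ) : Monotone (stepHigh n) := fun p q hpq =>
  Real.smoothTransition.monotone (by
    have := mul_le_mul_of_nonneg_left (sub_le_sub_right hpq 1) (Nat.cast_nonneg (α := ℝ) n)
    linarith)

theorem stepLow_deriv_ne_zero {n : ℕ} {p : ℝ} (h : deriv (stepLow n) p ≠ 0) :
    (n : ℝ) * p ≤ 2 := by
  have hd : HasDerivAt (stepLow n) (deriv Real.smoothTransition (n * p - 1) * (n * 1)) p :=
    (((Real.smoothTransition.contDiff (n := 1)).differentiable (by simp)
      ).differentiableAt.hasDerivAt).comp p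
      (((hasDerivAt_id p).const_mul (n : ℝ)).sub_const 1)
  rw [hd.deriv] at h
  have := (smoothTransition_deriv_ne_zero (left_ne_zero_of_mul h)).2
  linarith

theorem stepHigh_deriv_ne_zero {n : ℕ} {p : ℝ} (h : deriv (stepHigh n) p ≠ 0) :
    (n : ℝ) * (1 - p) ≤ 2 := by
  have hd : HasDerivAt (stepHigh n) (deriv Real.smoothTransition (n * (p - 1) + 2) * (n * 1)) p :=
    (((Real.smoothTransition.contDiff (n := 1)).differentiable (by simp)
      ).differentiableAt.hasDerivAt).comp p
      ((((hasDerivAt_id p).sub_const 1).const_mul (n : ℝ)).add_const 2)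
  rw [hd.deriv] at h
  have := (smoothTransition_deriv_ne_zero (left_ne_zero_of_mul h)).1
  linarith

theorem stepLow_zero (n : ℕ) : stepLow n 0 = 0 :=
  Real.smoothTransition.zero_of_nonpos (by norm_num)

theorem stepLow_one {n : ℕ} (hn : 3 ≤ n) : stepLow n 1 = 1 := by
  have : (3:ℝ) ≤ n := by exact_mod_cast hn
  exact Real.smoothTransition.one_of_one_le (by linarith)

theorem stepHigh_zero {n : ℕ} (hn : 3 ≤ n) : stepHigh n 0 = 0 := by
  have : (3:ℝ) ≤ n := by exact_mod_cast hn
  exact Real.smoothTransition.zero_of_nonpos (by linarith)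

theorem stepHigh_one (n : ℕ) : stepHigh n 1 = 1 :=
  Real.smoothTransition.one_of_one_le (by norm_num)

theorem abs_step_sub_le (n : ℕ) (p : ℝ) : |stepLow n p - stepHigh n p| ≤ 1 := by
  have h1 := Real.smoothTransition.nonneg (n * p - 1)
  have h2 := Real.smoothTransition.le_one (n * p - 1)
  have h3 := Real.smoothTransition.nonneg (n * (p - 1) + 2)
  have h4 := Real.smoothTransition.le_one (n * (p - 1) + 2)
  rw [abs_le]
  constructor <;> simp only [stepLow, stepHigh] <;> linarith

theorem step_sub_eq_zero {n : ℕ} (hn : 3 ≤ n) {p : ℝ}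
    (hp : p ∉ Icc ((n : ℝ)⁻¹) (1 - (n : ℝ)⁻¹)) : stepLow n p - stepHigh n p = 0 := by
  have hn3 : (3:ℝ) ≤ n := by exact_mod_cast hn
  have hn0 : (0:ℝ) < n := by linarith
  have hi : (n : ℝ) * (n : ℝ)⁻¹ = 1 := mul_inv_cancel₀ hn0.ne'
  rcases not_and_or.1 hp with h | h
  · have := mul_lt_mul_of_pos_left (not_le.1 h) hn0
    rw [stepLow, stepHigh, Real.smoothTransition.zero_of_nonpos (by linarith),
      Real.smoothTransition.zero_of_nonpos (by linarith), sub_zero]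
  · have := mul_lt_mul_of_pos_left (not_le.1 h) hn0
    rw [stepLow, stepHigh, Real.smoothTransition.one_of_one_le (by linarith),
      Real.smoothTransition.one_of_one_le (by linarith), sub_self]

theorem tendsto_step_sub {p : ℝ} (hp : p ∈ Ioo (0:ℝ) 1) :
    Tendsto (fun n : ℕ => stepLow n p - stepHigh n p) atTop (𝓝 1) := by
  refine tendsto_const_nhds.congr' ?_
  have h1 := (tendsto_natCast_atTop_atTop (R := ℝ)).atTop_mul_const hp.1
  have h2 := (tendsto_natCast_atTop_atTop (R := ℝ)).atTop_mul_const (sub_pos.2 hp.2)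
  filter_upwards [h1.eventually_ge_atTop 2, h2.eventually_ge_atTop 2] with n hn1 hn2
  rw [stepLow, stepHigh, Real.smoothTransition.one_of_one_le (by linarith),
      Real.smoothTransition.zero_of_nonpos (by linarith), sub_zero]

theorem eventually_small_near_zero_set {Z : Set (ℝ × ℝ)} (hZ : IsCompact Z) {g q : ℝ × ℝ → ℝ}
    (hg : ContinuousOn g Z) (hq : ContinuousOn q Z) (hq0 : ∀ z ∈ Z, 0 ≤ q z)
    (hgq : ∀ z ∈ Z, q z = 0 → g z = 0) {ε : ℝ} (hε : 0 < ε) :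
    ∀ᶠ n : ℕ in atTop, ∀ z ∈ Z, (n : ℝ) * q z ≤ 2 → |g z| ≤ ε := by
  have hK : IsCompact (Z ∩ (fun z => |g z|) ⁻¹' (Ici ε)) :=
    hZ.of_isClosed_subset (hg.abs.preimage_isClosed_of_isClosed hZ.isClosed isClosed_Ici)
      inter_subset_left
  rcases (Z ∩ (fun z => |g z|) ⁻¹' (Ici ε)).eq_empty_or_nonempty with he | hne
  · refine Eventually.of_forall fun n z hz _ => ?_
    by_contra hc
    have : z ∈ Z ∩ (fun z => |g z|) ⁻¹' (Ici ε) := ⟨hz, (not_le.1 hc).le⟩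
    rw [he] at this
    exact this
  · obtain ⟨w, hw, hmin⟩ := hK.exists_isMinOn hne (hq.mono inter_subset_left)
    have hqw : 0 < q w := by
      refine lt_of_le_of_ne (hq0 w hw.1) fun e => ?_
      have h1 : ε ≤ |g w| := hw.2
      rw [hgq w hw.1 e.symm, abs_zero] at h1
      linarith
    have h1 := (tendsto_natCast_atTop_atTop (R := ℝ)).atTop_mul_const hqw
    filter_upwards [h1.eventually_gt_atTop 2] with n hn z hz hnz
    by_contra hc
    have h2 : q w ≤ q z := hmin ⟨hz, (not_le.1 hc).le⟩
    have h3 := mul_le_mul_of_nonneg_left h2 (Nat.cast_nonneg (α := ℝ) n)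
    linarith

theorem deriv_eq_zero_of_notMem_Icc {χ : ℝ → ℝ} {a b : ℝ} (hχs : ∀ x, x ∉ Icc a b → χ x = 0)
    {x : ℝ} (hx : x ∉ Icc a b) : deriv χ x = 0 := by
  have : χ =ᶠ[𝓝 x] fun _ => 0 := by
    filter_upwards [isClosed_Icc.isOpen_compl.mem_nhds hx] with y hy
    exact hχs y hy
  rw [this.deriv_eq, deriv_const]

namespace Sol

variable {ω : ℝ → ℝ} {M r : ℝ} {ψ : ℝ × ℝ → ℝ} {η : ℝ → ℝ}

theorem tendsto_boundary_layers (h : Sol ω M r ψ η) {χ Φ : ℝ → ℝ}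
    (hχ : ContDiff ℝ 1 χ) {a b : ℝ} (hχs : ∀ x, x ∉ Icc a b → χ x = 0)
    (hΦ : ContDiff ℝ 1 Φ) (hΦ0 : Φ 0 = 0) :
    Tendsto (fun n : ℕ => ∫ z in dom η, χ z.1 * ((deriv (stepLow n) (ψ z) * py η ψ z
        * (Φ (ψ z) * (px η ψ z ^ 2 + py η ψ z ^ 2)))
        - deriv (stepHigh n) (ψ z) * py η ψ z * (Φ (ψ z) * (px η ψ z ^ 2 + py η ψ z ^ 2))))
      atTop (𝓝 (-∫ x, χ x * (Φ 1 * (3 * r - 2 * η x)))) := by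
  have hη := h.eta_continuous
  let F : ℝ × ℝ → ℝ := fun z => Φ (ψ z) * (px η ψ z ^ 2 + py η ψ z ^ 2)
  have hF : ContinuousOn F (domc η) := (hΦ.continuous.comp_continuousOn h.continuousOn).mul
    ((h.px_continuousOn.pow 2).add (h.py_continuousOn.pow 2))
  have hχc : HasCompactSupport χ := by
    refine isCompact_Icc.of_isClosed_subset (isClosed_tsupport χ)
      (closure_minimal (fun x hx => ?_) (isClosed_Icc (a := a) (b := b)))
    by_contra hc
    exact hx (hχs x hc)
  have hIχ : Integrable χ := hχ.continuous.integrable_of_hasCompactSupport hχc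
  set Z : Set (ℝ × ℝ) := {z | z ∈ domc η ∧ z.1 ∈ Icc a b} with hZdef
  have hZ : IsCompact Z := isCompact_domc_strip hη a b
  have hZd : Z ⊆ domc η := fun z hz => hz.1
  have htop : ∀ x, F (x, η x) = Φ 1 * (3 * r - 2 * η x) := by
    intro x
    simp only [F, h.surface]
    rw [← h.bern x]
    ring
  have hIb : Integrable fun x => χ x * (Φ 1 * (3 * r - 2 * η x)) :=
    (hχ.continuous.mul (by fun_prop)).integrable_of_hasCompactSupport hχc.mul_right
  rw [Metric.tendsto_atTop']
  intro ε hε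
  set B : ℝ := ∫ x, |χ x| with hB
  have hB0 : 0 ≤ B := integral_nonneg fun x => abs_nonneg _
  set δ : ℝ := ε / (2 * (B + 1)) with hδ
  have hδ0 : 0 < δ := by positivity
  have hlow := eventually_small_near_zero_set hZ (g := F) (q := ψ) (hF.mono hZd)
    (h.continuousOn.mono hZd) (fun z hz => (h.mem_Icc hz.1).1)
    (fun z _ hz0 => by simp [F, hz0, hΦ0]) hδ0
  have hhigh := eventually_small_near_zero_set hZ
    (g := fun z => F z - Φ 1 * (3 * r - 2 * η z.1)) (q := fun z => 1 - ψ z)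
    ((hF.mono hZd).sub (by fun_prop))
    (continuousOn_const.sub (h.continuousOn.mono hZd))
    (fun z hz => sub_nonneg.2 (h.mem_Icc hz.1).2)
    (fun z hz hz0 => by
      have hy : z.2 = η z.1 := by
        refine (h.vertical_strictMonoOn z.1).injOn hz.1 (right_mem_Icc.2 (h.eta_pos z.1).le) ?_
        show ψ z = ψ (z.1, η z.1)
        rw [h.surface]
        linarith
      have : z = (z.1, η z.1) := Prod.ext rfl hy
      rw [this, htop]
      simp) hδ0
  obtain ⟨N, hN⟩ := (hlow.and (hhigh.and (eventually_ge_atTop 3))).exists_forall_of_atTop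
  refine ⟨N, fun n hn => ?_⟩
  obtain ⟨hl, hh, hn3⟩ := hN n hn.le
  let kl : ℝ × ℝ → ℝ := fun z => deriv (stepLow n) (ψ z) * py η ψ z * F z
  let kh : ℝ × ℝ → ℝ := fun z => deriv (stepHigh n) (ψ z) * py η ψ z * F z
  have hkl : ContinuousOn kl (domc η) := ((((stepLow_contDiff n).continuous_deriv
    le_rfl).comp_continuousOn h.continuousOn).mul h.py_continuousOn).mul hF
  have hkh : ContinuousOn kh (domc η) := ((((stepHigh_contDiff n).continuous_deriv
    le_rfl).comp_continuousOn h.continuousOn).mul h.py_continuousOn).mul hF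
  have hχf : ContinuousOn (fun z : ℝ × ℝ => χ z.1) (domc η) :=
    (hχ.continuous.comp continuous_fst).continuousOn
  obtain ⟨-, hI, hfub⟩ := fubini_dom hη h.eta_pos (F := fun z => χ z.1 * (kl z - kh z))
    (hχf.mul (hkl.sub hkh)) (a := a) (b := b) (fun z hz => by rw [hχs _ hz, zero_mul])
  have hpt : ∀ x, |(∫ y in (0:ℝ)..η x, χ x * (kl (x, y) - kh (x, y)))
      + χ x * (Φ 1 * (3 * r - 2 * η x))| ≤ |χ x| * (2 * δ) := by
    intro x
    by_cases hx : x ∈ Icc a b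
    · have h1 := h.layer_bound (stepLow_contDiff n) (stepLow_monotone n) (stepLow_zero n)
        (stepLow_one hn3) hF (x := x) (c := 0) (ε := δ) (fun y hy hd => by
          rw [sub_zero]
          exact hl (x, y) ⟨hy, hx⟩ (stepLow_deriv_ne_zero hd))
      have h2 := h.layer_bound (stepHigh_contDiff n) (stepHigh_monotone n) (stepHigh_zero hn3)
        (stepHigh_one n) hF (x := x) (c := Φ 1 * (3 * r - 2 * η x)) (ε := δ) (fun y hy hd =>
          hh (x, y) ⟨hy, hx⟩ (stepHigh_deriv_ne_zero hd))
      rw [intervalIntegral.integral_const_mul,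
        intervalIntegral.integral_sub (h.slice_intervalIntegrable hkl x)
          (h.slice_intervalIntegrable hkh x), ← mul_add, abs_mul]
      refine mul_le_mul_of_nonneg_left ?_ (abs_nonneg _)
      rw [abs_le] at h1 h2 ⊢
      constructor <;> linarith [h1.1, h1.2, h2.1, h2.2]
    · simp [hχs x hx]
  rw [Real.dist_eq, sub_neg_eq_add]
  change |(∫ z in dom η, χ z.1 * (kl z - kh z)) + _| < ε
  rw [hfub, ← integral_add hI hIb]
  calc |∫ x, ((∫ y in (0:ℝ)..η x, χ x * (kl (x, y) - kh (x, y)))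
        + χ x * (Φ 1 * (3 * r - 2 * η x)))|
      ≤ ∫ x, |χ x| * (2 * δ) := by
        refine (abs_integral_le_integral_abs).trans ?_
        exact integral_mono (hI.add hIb).abs (hIχ.abs.mul_const _) hpt
    _ = B * (2 * δ) := integral_mul_const _ _
    _ < ε := by
        have : B * (2 * δ) = ε * (B / (B + 1)) := by rw [hδ]; field_simp
        rw [this]
        have h1 : B / (B + 1) < 1 := by rw [div_lt_one (by linarith)]; linarith
        nlinarith

theorem momentum_boundary (h : Sol ω M r ψ η) (hω : ContinuousOn ω (Icc 0 1)) {χ Φ : ℝ → ℝ}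
    (hχ : ContDiff ℝ 1 χ) {a b : ℝ} (hχs : ∀ x, x ∉ Icc a b → χ x = 0)
    (hΦ : ContDiff ℝ 1 Φ) (hΦ0 : Φ 0 = 0) :
    ∫ z in dom η, (2 * deriv χ z.1 * Φ (ψ z) * px η ψ z * py η ψ z
      + χ z.1 * deriv Φ (ψ z) * py η ψ z * (px η ψ z ^ 2 + py η ψ z ^ 2)
      - 2 * ω (ψ z) * χ z.1 * Φ (ψ z) * py η ψ z)
    = ∫ x, χ x * (Φ 1 * (3 * r - 2 * η x)) := by
  have hη := h.eta_continuous
  have hdm : MeasurableSet (dom η) := (isOpen_dom hη).measurableSet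
  have hχ' : ∀ x, x ∉ Icc a b → deriv χ x = 0 := fun x hx => deriv_eq_zero_of_notMem_Icc hχs hx
  have hχf : ContinuousOn (fun z : ℝ × ℝ => χ z.1) (domc η) :=
    (hχ.continuous.comp continuous_fst).continuousOn
  have hχd : ContinuousOn (fun z : ℝ × ℝ => deriv χ z.1) (domc η) :=
    ((hχ.continuous_deriv le_rfl).comp continuous_fst).continuousOn
  have hΦf : ContinuousOn (fun z => Φ (ψ z)) (domc η) :=
    hΦ.continuous.comp_continuousOn h.continuousOn
  have hΦd : ContinuousOn (fun z => deriv Φ (ψ z)) (domc η) :=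
    (hΦ.continuous_deriv le_rfl).comp_continuousOn h.continuousOn
  have hpx := h.px_continuousOn
  have hpy := h.py_continuousOn
  have hom := h.omega_continuousOn hω
  let G : ℝ × ℝ → ℝ := fun z => 2 * deriv χ z.1 * Φ (ψ z) * px η ψ z * py η ψ z
      + χ z.1 * deriv Φ (ψ z) * py η ψ z * (px η ψ z ^ 2 + py η ψ z ^ 2)
      - 2 * ω (ψ z) * χ z.1 * Φ (ψ z) * py η ψ z
  have hG : ContinuousOn G (domc η) := by
    refine ContinuousOn.sub (ContinuousOn.add ?_ ?_) ?_
    · exact (((continuousOn_const.mul hχd).mul hΦf).mul hpx).mul hpy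
    · exact ((hχf.mul hΦd).mul hpy).mul ((hpx.pow 2).add (hpy.pow 2))
    · exact (((continuousOn_const.mul hom).mul hχf).mul hΦf).mul hpy
  have hGI : IntegrableOn G (dom η) := (fubini_dom hη h.eta_pos hG (a := a) (b := b)
    fun z hz => by simp [G, hχs _ hz, hχ' _ hz]).1
  have hc : ∀ n : ℕ, ContDiff ℝ 1 fun p => stepLow n p - stepHigh n p := fun n =>
    (stepLow_contDiff n).sub (stepHigh_contDiff n)
  have hcG : ∀ n : ℕ, ContinuousOn (fun z => (stepLow n (ψ z) - stepHigh n (ψ z)) * G z)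
      (domc η) := fun n => ((hc n).continuous.comp_continuousOn h.continuousOn).mul hG
  have hlim1 : Tendsto (fun n : ℕ => ∫ z in dom η, (stepLow n (ψ z) - stepHigh n (ψ z)) * G z)
      atTop (𝓝 (∫ z in dom η, G z)) := by
    refine tendsto_integral_of_dominated_convergence (fun z => |G z|) (fun n => ?_) hGI.abs ?_ ?_
    · exact ((hcG n).mono (dom_subset_domc η)).aestronglyMeasurable hdm
    · refine fun n => Eventually.of_forall fun z => ?_
      rw [Real.norm_eq_abs, abs_mul]
      exact mul_le_of_le_one_left (abs_nonneg _) (abs_step_sub_le n _)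
    · refine (ae_restrict_iff' hdm).2 (Eventually.of_forall fun z hz => ?_)
      simpa using (tendsto_step_sub (h.mem_Ioo hz)).mul_const (G z)
  have hlim2 := h.tendsto_boundary_layers hχ hχs hΦ hΦ0
  have hzero : ∀ᶠ n : ℕ in atTop, (∫ z in dom η, (stepLow n (ψ z) - stepHigh n (ψ z)) * G z)
      + (∫ z in dom η, χ z.1 * ((deriv (stepLow n) (ψ z) * py η ψ z
        * (Φ (ψ z) * (px η ψ z ^ 2 + py η ψ z ^ 2)))
        - deriv (stepHigh n) (ψ z) * py η ψ z * (Φ (ψ z) * (px η ψ z ^ 2 + py η ψ z ^ 2)))) = 0 := by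
    filter_upwards [eventually_ge_atTop 3] with n hn3
    have hsl : ContinuousOn (fun z => deriv (stepLow n) (ψ z)) (domc η) :=
      ((stepLow_contDiff n).continuous_deriv le_rfl).comp_continuousOn h.continuousOn
    have hsh : ContinuousOn (fun z => deriv (stepHigh n) (ψ z)) (domc η) :=
      ((stepHigh_contDiff n).continuous_deriv le_rfl).comp_continuousOn h.continuousOn
    have hF := hΦf.mul ((hpx.pow 2).add (hpy.pow 2))
    rw [← integral_add]
    · have hn0 : (0:ℝ) < (n : ℝ)⁻¹ := by
        have : (3:ℝ) ≤ n := by exact_mod_cast hn3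
        positivity
      refine Eq.trans ?_ (h.momentum_levels hω hχ hχs (θ := fun p =>
        Φ p * (stepLow n p - stepHigh n p)) (hΦ.mul (hc n)) hn0
        (fun p hp => by rw [step_sub_eq_zero hn3 hp, mul_zero]))
      refine integral_congr_ae (Eventually.of_forall fun z => ?_)
      have hd : HasDerivAt (fun p => Φ p * (stepLow n p - stepHigh n p))
          (deriv Φ (ψ z) * (stepLow n (ψ z) - stepHigh n (ψ z))
            + Φ (ψ z) * (deriv (stepLow n) (ψ z) - deriv (stepHigh n) (ψ z))) (ψ z) :=
        (hΦ.differentiable one_ne_zero).differentiableAt.hasDerivAt.mul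
          (((stepLow_contDiff n).differentiable one_ne_zero).differentiableAt.hasDerivAt.sub
            ((stepHigh_contDiff n).differentiable one_ne_zero).differentiableAt.hasDerivAt)
      simp only [hd.deriv, G]
      ring
    · exact (fubini_dom hη h.eta_pos (hcG n) (a := a) (b := b)
        fun z hz => by simp [G, hχs _ hz, hχ' _ hz]).1
    · exact (fubini_dom hη h.eta_pos (hχf.mul (((hsl.mul hpy).mul hF).sub
        ((hsh.mul hpy).mul hF))) (a := a) (b := b) fun z hz => by simp [hχs _ hz]).1
  have hfin := tendsto_nhds_unique ((hlim1.add hlim2).congr' hzero) tendsto_const_nhds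
  change ∫ z in dom η, G z = _
  linarith

end Sol

section

/-- The shear-flow velocity `√(s - 2 Ω(p))` in the variable `s = λ²`, extended to all of `ℝ` by
clamping `p` to `[0, 1]`. -/
def shear (ω : ℝ → ℝ) (s p : ℝ) : ℝ := Real.sqrt (s - 2 * Om ω (max 0 (min 1 p)))

theorem clamp_mem (p : ℝ) : max 0 (min 1 p) ∈ Icc (0:ℝ) 1 :=
  ⟨le_max_left _ _, max_le zero_le_one (min_le_left _ _)⟩

theorem clamp_eq {p : ℝ} (hp : p ∈ Icc (0:ℝ) 1) : max 0 (min 1 p) = p := by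
  rw [min_eq_right hp.2, max_eq_right hp.1]

theorem Om_eq_clamp (ω : ℝ → ℝ) {p : ℝ} (hp : p ∈ Icc (0:ℝ) 1) :
    Om ω p = ∫ t in (0:ℝ)..p, ω (max 0 (min 1 t)) := by
  refine intervalIntegral.integral_congr fun t ht => ?_
  rw [uIcc_of_le hp.1] at ht
  show ω t = ω (max 0 (min 1 t))
  rw [clamp_eq ⟨ht.1, ht.2.trans hp.2⟩]

variable {ω : ℝ → ℝ}

theorem clamp_omega_continuous (hω : ContinuousOn ω (Icc 0 1)) :
    Continuous fun t => ω (max 0 (min 1 t)) :=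
  hω.comp_continuous (by fun_prop) clamp_mem

theorem Om_hasDerivAt_clamp (hω : ContinuousOn ω (Icc 0 1)) (p : ℝ) :
    HasDerivAt (fun p => ∫ t in (0:ℝ)..p, ω (max 0 (min 1 t))) (ω (max 0 (min 1 p))) p :=
  (clamp_omega_continuous hω).integral_hasStrictDerivAt 0 p |>.hasDerivAt

theorem Om_continuousOn (hω : ContinuousOn ω (Icc 0 1)) : ContinuousOn (Om ω) (Icc 0 1) :=
  ContinuousOn.congr
    (fun p _ => (Om_hasDerivAt_clamp hω p).continuousAt.continuousWithinAt)
    fun _ hp => Om_eq_clamp ω hp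

theorem two_Om_le (hω : ContinuousOn ω (Icc 0 1)) {p : ℝ} (hp : p ∈ Icc (0:ℝ) 1) :
    2 * Om ω p ≤ lam0 ω ^ 2 := by
  have hb : BddAbove (Om ω '' Icc (0:ℝ) 1) := isCompact_Icc.bddAbove_image (Om_continuousOn hω)
  have h1 : ∀ p ∈ Icc (0:ℝ) 1, Om ω p ≤ sSup (Om ω '' Icc (0:ℝ) 1) := fun p hp =>
    le_csSup hb (mem_image_of_mem _ hp)
  have h0 : 0 ≤ sSup (Om ω '' Icc (0:ℝ) 1) := by
    have := h1 0 (left_mem_Icc.2 zero_le_one)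
    simpa [Om] using this
  rw [lam0, Real.sq_sqrt (by linarith)]
  linarith [h1 p hp]

theorem lam0_nonneg (ω : ℝ → ℝ) : 0 ≤ lam0 ω := Real.sqrt_nonneg _

theorem lam0_sq_lt {lam : ℝ} (h : lam0 ω < lam) : lam0 ω ^ 2 < lam ^ 2 :=
  pow_lt_pow_left₀ h (lam0_nonneg ω) two_ne_zero

theorem sub_two_Om_pos (hω : ContinuousOn ω (Icc 0 1)) {s : ℝ} (hs : lam0 ω ^ 2 < s) (p : ℝ) :
    0 < s - 2 * Om ω (max 0 (min 1 p)) := by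
  linarith [two_Om_le hω (clamp_mem p)]

theorem shear_pos (hω : ContinuousOn ω (Icc 0 1)) {s : ℝ} (hs : lam0 ω ^ 2 < s) (p : ℝ) :
    0 < shear ω s p := Real.sqrt_pos.2 (sub_two_Om_pos hω hs p)

theorem shear_sq (hω : ContinuousOn ω (Icc 0 1)) {s : ℝ} (hs : lam0 ω ^ 2 < s) (p : ℝ) :
    shear ω s p ^ 2 = s - 2 * Om ω (max 0 (min 1 p)) :=
  Real.sq_sqrt (sub_two_Om_pos hω hs p).le

theorem shear_continuous (hω : ContinuousOn ω (Icc 0 1)) (s : ℝ) : Continuous (shear ω s) :=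
  (continuous_const.sub (continuous_const.mul
    ((Om_continuousOn hω).comp_continuous (by fun_prop) clamp_mem))).sqrt

theorem shear_inv_pow_continuous (hω : ContinuousOn ω (Icc 0 1)) {s : ℝ} (hs : lam0 ω ^ 2 < s)
    (n : ℕ) : Continuous fun p => (shear ω s p)⁻¹ ^ n :=
  ((shear_continuous hω s).inv₀ fun p => (shear_pos hω hs p).ne').pow n

/-- The moments `∫₀¹ (s - 2 Ω(p))^{-n/2} dp`. -/
def shearMoment (ω : ℝ → ℝ) (n : ℕ) (s : ℝ) : ℝ := ∫ p in (0:ℝ)..1, (shear ω s p)⁻¹ ^ n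

theorem dep_eq_shearMoment (ω : ℝ → ℝ) (lam : ℝ) : dep ω lam = shearMoment ω 1 (lam ^ 2) := by
  refine intervalIntegral.integral_congr fun p hp => ?_
  rw [uIcc_of_le zero_le_one] at hp
  simp only [Hp, shear, clamp_eq hp, pow_one]

theorem shearMoment_continuousAt (hω : ContinuousOn ω (Icc 0 1)) {s : ℝ} (hs : lam0 ω ^ 2 < s)
    (n : ℕ) : ContinuousAt (shearMoment ω n) s := by
  set m : ℝ := (lam0 ω ^ 2 + s) / 2 with hm
  have hm1 : lam0 ω ^ 2 < m := by linarith
  have hms : m < s := by linarith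
  refine intervalIntegral.continuousAt_of_dominated_interval
    (bound := fun _ => ((Real.sqrt (m - lam0 ω ^ 2))⁻¹) ^ n) ?_ ?_ intervalIntegrable_const ?_
  · filter_upwards [Ioi_mem_nhds hms] with t ht
    exact (shear_inv_pow_continuous hω (hm1.trans ht) n).aestronglyMeasurable
  · filter_upwards [Ioi_mem_nhds hms] with t ht
    refine Eventually.of_forall fun p _ => ?_
    have hp := shear_pos hω (hm1.trans ht) p
    rw [Real.norm_eq_abs, abs_of_nonneg (by positivity)]
    have h1 : Real.sqrt (m - lam0 ω ^ 2) ≤ shear ω t p := by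
      refine Real.sqrt_le_sqrt ?_
      have := two_Om_le hω (clamp_mem p)
      have : m < t := ht
      linarith
    have h2 : 0 < Real.sqrt (m - lam0 ω ^ 2) := Real.sqrt_pos.2 (by linarith)
    gcongr
  · refine Eventually.of_forall fun p _ => ?_
    have hsh : ContinuousAt (fun t => shear ω t p) s := by
      unfold shear
      fun_prop
    exact (hsh.inv₀ (shear_pos hω hs p).ne').pow n

theorem shearMoment_tangent (hω : ContinuousOn ω (Icc 0 1)) {s t : ℝ} (hs : lam0 ω ^ 2 < s)
    (ht : lam0 ω ^ 2 < t) :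
    2 * shearMoment ω 1 t - (s - t) * shearMoment ω 3 t ≤ 2 * shearMoment ω 1 s := by
  have hi : ∀ {s : ℝ}, lam0 ω ^ 2 < s → ∀ n : ℕ,
      IntervalIntegrable (fun p => (shear ω s p)⁻¹ ^ n) volume 0 1 := fun hs n =>
    (shear_inv_pow_continuous hω hs n).intervalIntegrable _ _
  unfold shearMoment
  rw [← intervalIntegral.integral_const_mul, ← intervalIntegral.integral_const_mul,
    ← intervalIntegral.integral_const_mul,
    ← intervalIntegral.integral_sub ((hi ht 1).const_mul _) ((hi ht 3).const_mul _)]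
  refine intervalIntegral.integral_mono_on zero_le_one
    (((hi ht 1).const_mul _).sub ((hi ht 3).const_mul _)) ((hi hs 1).const_mul _) ?_
  intro p _
  have hu := shear_pos hω hs p
  have hv := shear_pos hω ht p
  have e : s - t = shear ω s p ^ 2 - shear ω t p ^ 2 := by
    rw [shear_sq hω hs, shear_sq hω ht]; ring
  rw [e]
  set u := shear ω s p
  set v := shear ω t p
  have key : 2 * u⁻¹ ^ 1 - (2 * v⁻¹ ^ 1 - (u ^ 2 - v ^ 2) * v⁻¹ ^ 3)
      = (u - v) ^ 2 * (u + 2 * v) * (u⁻¹ * v⁻¹ ^ 3) := by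
    field_simp
    ring
  have : 0 ≤ (u - v) ^ 2 * (u + 2 * v) * (u⁻¹ * v⁻¹ ^ 3) := by positivity
  linarith

theorem RR_eq (ω : ℝ → ℝ) (lam : ℝ) :
    RR ω lam = (lam ^ 2 - 2 * Om ω 1 + 2 * shearMoment ω 1 (lam ^ 2)) / 3 := by
  rw [RR, dep_eq_shearMoment]

namespace Crit

variable {lamc rc : ℝ}

theorem lam0_sq_lt (hc : Crit ω lamc rc) : lam0 ω ^ 2 < lamc ^ 2 := BL.lam0_sq_lt hc.lt

theorem le_of_sq (hc : Crit ω lamc rc) {s : ℝ} (hs : lam0 ω ^ 2 < s) :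
    lamc ^ 2 + 2 * shearMoment ω 1 (lamc ^ 2) ≤ s + 2 * shearMoment ω 1 s := by
  have hs0 : 0 ≤ s := (sq_nonneg _).trans hs.le
  have h := hc.isMin (Real.sqrt s) (Real.lt_sqrt_of_sq_lt hs)
  rw [RR_eq, RR_eq, Real.sq_sqrt hs0] at h
  linarith

theorem one_le_moment (hω : ContinuousOn ω (Icc 0 1)) (hc : Crit ω lamc rc) {s : ℝ}
    (hs : lam0 ω ^ 2 < s) (hsc : s < lamc ^ 2) : 1 ≤ shearMoment ω 3 s := by
  have h1 := shearMoment_tangent hω hc.lam0_sq_lt hs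
  have h2 := hc.le_of_sq hs
  by_contra hlt
  have := mul_pos (sub_pos.2 hsc) (sub_pos.2 (not_le.1 hlt))
  linarith

theorem moment_le_one (hω : ContinuousOn ω (Icc 0 1)) (hc : Crit ω lamc rc) {s : ℝ}
    (hsc : lamc ^ 2 < s) : shearMoment ω 3 s ≤ 1 := by
  have hs := hc.lam0_sq_lt.trans hsc
  have h1 := shearMoment_tangent hω hc.lam0_sq_lt hs
  have h2 := hc.le_of_sq hs
  by_contra hlt
  have := mul_pos (sub_pos.2 hsc) (sub_pos.2 (not_le.1 hlt))
  linarith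

theorem moment_eq_one (hω : ContinuousOn ω (Icc 0 1)) (hc : Crit ω lamc rc) :
    shearMoment ω 3 (lamc ^ 2) = 1 := by
  have hcont := shearMoment_continuousAt hω hc.lam0_sq_lt 3
  refine le_antisymm ?_ ?_
  · refine le_of_tendsto (hcont.tendsto.mono_left (nhdsWithin_le_nhds (s := Ioi (lamc ^ 2)))) ?_
    filter_upwards [self_mem_nhdsWithin] with s hs
    exact hc.moment_le_one hω hs
  · refine ge_of_tendsto (hcont.tendsto.mono_left (nhdsWithin_le_nhds (s := Iio (lamc ^ 2)))) ?_
    filter_upwards [self_mem_nhdsWithin, nhdsWithin_le_nhds (Ioi_mem_nhds hc.lam0_sq_lt)]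
      with s hs hs'
    exact hc.one_le_moment hω hs' hs

theorem RR_antitone (hω : ContinuousOn ω (Icc 0 1)) (hc : Crit ω lamc rc) {a b : ℝ}
    (ha : lam0 ω < a) (hab : a < b) (hb : b < lamc) : RR ω b ≤ RR ω a := by
  have ha0 := (lam0_nonneg ω).trans ha.le
  have hs := BL.lam0_sq_lt (ha.trans hab)
  have hsc : b ^ 2 < lamc ^ 2 := pow_lt_pow_left₀ hb (ha0.trans hab.le) two_ne_zero
  have h1 := shearMoment_tangent hω (BL.lam0_sq_lt ha) hs
  have h2 := hc.one_le_moment hω hs hsc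
  have h3 : a ^ 2 < b ^ 2 := pow_lt_pow_left₀ hab ha0 two_ne_zero
  have := mul_nonneg (sub_pos.2 h3).le (sub_nonneg.2 h2)
  rw [RR_eq, RR_eq]
  linarith

theorem exists_depth_close (hω : ContinuousOn ω (Icc 0 1)) (hc : Crit ω lamc rc) {ε : ℝ}
    (hε : 0 < ε) : ∃ r₁, rc < r₁ ∧ ∀ lam, lam0 ω < lam → lam < lamc → RR ω lam < r₁ →
      |dep ω lam - dep ω lamc| < ε := by
  have hcont : ContinuousAt (dep ω) lamc := by
    have h1 := shearMoment_continuousAt hω hc.lam0_sq_lt 1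
    have h2 : ContinuousAt (fun lam : ℝ => shearMoment ω 1 (lam ^ 2)) lamc :=
      ContinuousAt.comp (f := fun lam : ℝ => lam ^ 2) h1 (by fun_prop)
    exact h2.congr (Eventually.of_forall fun lam => (dep_eq_shearMoment ω lam).symm)
  obtain ⟨δ, hδ, hd⟩ := Metric.continuousAt_iff.1 hcont ε hε
  have hlt := hc.lt
  set l : ℝ := max (lamc - δ / 2) ((lam0 ω + lamc) / 2) with hl
  have hl0 : lam0 ω < l := lt_of_lt_of_le (by linarith) (le_max_right _ _)
  have hlc : l < lamc := max_lt (by linarith) (by linarith)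
  refine ⟨RR ω l, ?_, fun lam h0 h1 h2 => ?_⟩
  · rw [hc.val]
    exact lt_of_le_of_ne (hc.isMin l hl0) fun e => hlc.ne (hc.uniq l hl0 e.symm)
  · have hle : l ≤ lam := by
      by_contra hcon
      exact absurd (hc.RR_antitone hω h0 (not_le.1 hcon) hlc) (not_le.2 h2)
    have h3 : lamc - δ / 2 ≤ l := le_max_left _ _
    have := hd (x := lam) (by rw [Real.dist_eq, abs_lt]; constructor <;> linarith)
    rwa [Real.dist_eq] at this

end Crit

end

section

/-- `Φ(p) = ∫₀^p (s - 2 Ω(τ))^{-3/2} dτ`, the derivative of the shear-flow height in `-s / 2`. -/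
def stretch (ω : ℝ → ℝ) (s p : ℝ) : ℝ := ∫ t in (0:ℝ)..p, (shear ω s t)⁻¹ ^ 3

variable {ω : ℝ → ℝ} {s : ℝ}

theorem stretch_hasDerivAt (hω : ContinuousOn ω (Icc 0 1)) (hs : lam0 ω ^ 2 < s) (p : ℝ) :
    HasDerivAt (stretch ω s) ((shear ω s p)⁻¹ ^ 3) p :=
  (shear_inv_pow_continuous hω hs 3).integral_hasStrictDerivAt 0 p |>.hasDerivAt

theorem stretch_deriv (hω : ContinuousOn ω (Icc 0 1)) (hs : lam0 ω ^ 2 < s) :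
    deriv (stretch ω s) = fun p => (shear ω s p)⁻¹ ^ 3 :=
  funext fun p => (stretch_hasDerivAt hω hs p).deriv

theorem stretch_contDiff (hω : ContinuousOn ω (Icc 0 1)) (hs : lam0 ω ^ 2 < s) :
    ContDiff ℝ 1 (stretch ω s) := by
  refine contDiff_one_iff_deriv.2 ⟨fun p => (stretch_hasDerivAt hω hs p).differentiableAt, ?_⟩
  rw [stretch_deriv hω hs]
  exact shear_inv_pow_continuous hω hs 3

theorem stretch_zero (ω : ℝ → ℝ) (s : ℝ) : stretch ω s 0 = 0 := intervalIntegral.integral_same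

theorem stretch_monotone (hω : ContinuousOn ω (Icc 0 1)) (hs : lam0 ω ^ 2 < s) :
    Monotone (stretch ω s) := by
  refine monotone_of_deriv_nonneg (fun p => (stretch_hasDerivAt hω hs p).differentiableAt) ?_
  intro p
  rw [stretch_deriv hω hs]
  have := shear_pos hω hs p
  positivity

theorem integral_omega_stretch (hω : ContinuousOn ω (Icc 0 1)) (hs : lam0 ω ^ 2 < s) :
    ∫ p in (0:ℝ)..1, 2 * (ω p * stretch ω s p)
      = shearMoment ω 1 s - (s - 2 * Om ω 1) * stretch ω s 1 := by
  have hi1 : IntervalIntegrable (fun p => (shear ω s p)⁻¹ ^ 1) volume 0 1 :=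
    (shear_inv_pow_continuous hω hs 1).intervalIntegrable _ _
  have hi2 : IntervalIntegrable (fun p => 2 * (ω p * stretch ω s p)) volume 0 1 := by
    refine ContinuousOn.intervalIntegrable ?_
    rw [uIcc_of_le zero_le_one]
    exact continuousOn_const.mul (hω.mul (stretch_contDiff hω hs).continuous.continuousOn)
  have key := intervalIntegral.integral_eq_sub_of_hasDerivAt (a := 0) (b := 1)
    (f := fun p => (s - 2 * ∫ t in (0:ℝ)..p, ω (max 0 (min 1 t))) * stretch ω s p)
    (f' := fun p => (shear ω s p)⁻¹ ^ 1 - 2 * (ω p * stretch ω s p)) ?_ (hi1.sub hi2)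
  · rw [intervalIntegral.integral_sub hi1 hi2, stretch_zero, mul_zero, sub_zero,
      ← Om_eq_clamp ω (right_mem_Icc.2 zero_le_one)] at key
    have e : (∫ p in (0:ℝ)..1, (shear ω s p)⁻¹ ^ 1) = shearMoment ω 1 s := rfl
    rw [e] at key
    linarith
  · intro p hp
    rw [uIcc_of_le zero_le_one] at hp
    have hd := ((((Om_hasDerivAt_clamp hω p).const_mul 2).const_sub s).mul
      (stretch_hasDerivAt hω hs p))
    refine hd.congr_deriv ?_
    have h1 := shear_sq hω hs p
    rw [clamp_eq hp] at h1
    rw [clamp_eq hp, ← Om_eq_clamp ω hp, ← h1]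
    have := (shear_pos hω hs p).ne'
    field_simp
    ring

/-- The density of the near-critical energy functional. -/
def excess (ω : ℝ → ℝ) (s : ℝ) (η : ℝ → ℝ) (ψ : ℝ × ℝ → ℝ) (z : ℝ × ℝ) : ℝ :=
  1 - 3 / 2 * (py η ψ z * (shear ω s (ψ z))⁻¹)
    + 1 / 2 * (py η ψ z * (px η ψ z ^ 2 + py η ψ z ^ 2) * (shear ω s (ψ z))⁻¹ ^ 3)

namespace Sol

variable {M r : ℝ} {ψ : ℝ × ℝ → ℝ} {η : ℝ → ℝ}

theorem shear_continuousOn (h : Sol ω M r ψ η) (hω : ContinuousOn ω (Icc 0 1))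
    (hs : lam0 ω ^ 2 < s) (n : ℕ) :
    ContinuousOn (fun z => (shear ω s (ψ z))⁻¹ ^ n) (domc η) :=
  (shear_inv_pow_continuous hω hs n).comp_continuousOn h.continuousOn

theorem excess_continuousOn (h : Sol ω M r ψ η) (hω : ContinuousOn ω (Icc 0 1))
    (hs : lam0 ω ^ 2 < s) : ContinuousOn (excess ω s η ψ) (domc η) := by
  have h1 : ContinuousOn (fun z => (shear ω s (ψ z))⁻¹) (domc η) := by
    simpa using h.shear_continuousOn hω hs 1
  exact (continuousOn_const.sub (continuousOn_const.mul (h.py_continuousOn.mul h1))).add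
    (continuousOn_const.mul ((h.py_continuousOn.mul ((h.px_continuousOn.pow 2).add
      (h.py_continuousOn.pow 2))).mul (h.shear_continuousOn hω hs 3)))

theorem excess_lower (h : Sol ω M r ψ η) (hω : ContinuousOn ω (Icc 0 1)) (hs : lam0 ω ^ 2 < s)
    {z : ℝ × ℝ} (hz : z ∈ domc η) :
    (1 - py η ψ z * (shear ω s (ψ z))⁻¹) ^ 2
      + 1 / 2 * (px η ψ z ^ 2 * py η ψ z * (shear ω s (ψ z))⁻¹ ^ 3) ≤ excess ω s η ψ z := by
  have hk := inv_pos.2 (shear_pos hω hs (ψ z))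
  have hp := h.unidir z hz
  unfold excess
  generalize (shear ω s (ψ z))⁻¹ = k at *
  generalize py η ψ z = v at *
  generalize px η ψ z = u at *
  have h1 : 0 ≤ (1 - v * k) ^ 2 * (v * k) := by positivity
  nlinarith [h1]

theorem integral_excess (h : Sol ω M r ψ η) (hω : ContinuousOn ω (Icc 0 1)) {lamc rc : ℝ}
    (hc : Crit ω lamc rc) {χ : ℝ → ℝ} (hχ : ContDiff ℝ 1 χ) {a b : ℝ}
    (hχs : ∀ x, x ∉ Icc a b → χ x = 0) :
    Integrable (fun x => ∫ y in (0:ℝ)..η x, (χ x * excess ω (lamc ^ 2) η ψ (x, y)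
      + deriv χ x * stretch ω (lamc ^ 2) (ψ (x, y)) * px η ψ (x, y) * py η ψ (x, y))) ∧
    ∫ x, ∫ y in (0:ℝ)..η x, (χ x * excess ω (lamc ^ 2) η ψ (x, y)
      + deriv χ x * stretch ω (lamc ^ 2) (ψ (x, y)) * px η ψ (x, y) * py η ψ (x, y))
    = ∫ x, χ x * (3 / 2 * (r - rc)) := by
  have hs := hc.lam0_sq_lt
  set s := lamc ^ 2 with hsdef
  have hη := h.eta_continuous
  have hΦ := stretch_contDiff hω hs
  have hΦ1 : stretch ω s 1 = 1 := hc.moment_eq_one hω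
  have hrc : 3 * rc = s - 2 * Om ω 1 + 2 * shearMoment ω 1 s := by
    rw [hc.val, RR_eq]; ring
  have hχ' : ∀ x, x ∉ Icc a b → deriv χ x = 0 := fun x hx => deriv_eq_zero_of_notMem_Icc hχs hx
  have hχf : ContinuousOn (fun z : ℝ × ℝ => χ z.1) (domc η) :=
    (hχ.continuous.comp continuous_fst).continuousOn
  have hχd : ContinuousOn (fun z : ℝ × ℝ => deriv χ z.1) (domc η) :=
    ((hχ.continuous_deriv le_rfl).comp continuous_fst).continuousOn
  have hΦf : ContinuousOn (fun z => stretch ω s (ψ z)) (domc η) :=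
    hΦ.continuous.comp_continuousOn h.continuousOn
  have hΦd := h.shear_continuousOn hω hs 3
  have hk1 := h.shear_continuousOn hω hs 1
  have hpx := h.px_continuousOn
  have hpy := h.py_continuousOn
  have hom := h.omega_continuousOn hω
  have hex := h.excess_continuousOn hω hs
  have hχc : HasCompactSupport χ := by
    refine isCompact_Icc.of_isClosed_subset (isClosed_tsupport χ)
      (closure_minimal (fun x hx => ?_) (isClosed_Icc (a := a) (b := b)))
    by_contra hc
    exact hx (hχs x hc)
  have hmb := h.momentum_boundary hω hχ hχs hΦ (stretch_zero ω s)
  simp only [stretch_deriv hω hs, hΦ1, one_mul] at hmb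
  let G : ℝ × ℝ → ℝ := fun z => 2 * deriv χ z.1 * stretch ω s (ψ z) * px η ψ z * py η ψ z
      + χ z.1 * (shear ω s (ψ z))⁻¹ ^ 3 * py η ψ z * (px η ψ z ^ 2 + py η ψ z ^ 2)
      - 2 * ω (ψ z) * χ z.1 * stretch ω s (ψ z) * py η ψ z
  have hG : ContinuousOn G (domc η) := by
    refine ContinuousOn.sub (ContinuousOn.add ?_ ?_) ?_
    · exact (((continuousOn_const.mul hχd).mul hΦf).mul hpx).mul hpy
    · exact ((hχf.mul hΦd).mul hpy).mul ((hpx.pow 2).add (hpy.pow 2))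
    · exact (((continuousOn_const.mul hom).mul hχf).mul hΦf).mul hpy
  obtain ⟨-, hGI, hGfub⟩ := fubini_dom hη h.eta_pos hG (a := a) (b := b)
    fun z hz => by simp [G, hχs _ hz, hχ' _ hz]
  have hGval : ∫ x, ∫ y in (0:ℝ)..η x, G (x, y) = ∫ x, χ x * (3 * r - 2 * η x) := by
    rw [← hGfub]; exact hmb
  let T : ℝ × ℝ → ℝ := fun z => χ z.1 * excess ω s η ψ z
      + deriv χ z.1 * stretch ω s (ψ z) * px η ψ z * py η ψ z
  have hT : ContinuousOn T (domc η) := (hχf.mul hex).add (((hχd.mul hΦf).mul hpx).mul hpy)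
  obtain ⟨-, hTI, -⟩ := fubini_dom hη h.eta_pos hT (a := a) (b := b)
    fun z hz => by simp [T, hχs _ hz, hχ' _ hz]
  refine ⟨hTI, ?_⟩
  have hslice : ∀ x, ∫ y in (0:ℝ)..η x, T (x, y)
      = χ x * (η x - 3 / 2 * shearMoment ω 1 s
        + 1 / 2 * (shearMoment ω 1 s - (s - 2 * Om ω 1)))
        + 1 / 2 * ∫ y in (0:ℝ)..η x, G (x, y) := by
    intro x
    have i1 : ∫ y in (0:ℝ)..η x, (shear ω s (ψ (x, y)))⁻¹ ^ 1 * py η ψ (x, y)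
        = shearMoment ω 1 s :=
      h.integral_comp_vertical (g := fun p => (shear ω s p)⁻¹ ^ 1)
        (shear_inv_pow_continuous hω hs 1).continuousOn x
    have i2 : ∫ y in (0:ℝ)..η x, 2 * (ω (ψ (x, y)) * stretch ω s (ψ (x, y))) * py η ψ (x, y)
        = shearMoment ω 1 s - (s - 2 * Om ω 1) := by
      rw [h.integral_comp_vertical (g := fun p => 2 * (ω p * stretch ω s p))
        (continuousOn_const.mul (hω.mul hΦ.continuous.continuousOn)) x,
        integral_omega_stretch hω hs, hΦ1, mul_one]
    have i0 : ∫ _ in (0:ℝ)..η x, (1:ℝ) = η x := by simp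
    have j1 := h.slice_intervalIntegrable (hk1.mul hpy) x
    have j2 := h.slice_intervalIntegrable ((continuousOn_const (c := (2:ℝ))).mul (hom.mul hΦf)
      |>.mul hpy) x
    have j3 := h.slice_intervalIntegrable hG x
    have hTe : ∫ y in (0:ℝ)..η x, T (x, y) = ∫ y in (0:ℝ)..η x,
        (χ x * (1 - 3 / 2 * ((shear ω s (ψ (x, y)))⁻¹ ^ 1 * py η ψ (x, y))
          + 1 / 2 * (2 * (ω (ψ (x, y)) * stretch ω s (ψ (x, y))) * py η ψ (x, y)))
          + 1 / 2 * G (x, y)) := by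
      refine intervalIntegral.integral_congr fun y _ => ?_
      simp only [T, G, excess, pow_one]
      ring
    have k1 : IntervalIntegrable (fun _ => (1:ℝ)) volume 0 (η x) := intervalIntegrable_const
    have k2 := k1.sub (j1.const_mul (3 / 2))
    have k3 := k2.add (j2.const_mul (1 / 2))
    rw [hTe]
    erw [intervalIntegral.integral_add (k3.const_mul _) (j3.const_mul _),
      intervalIntegral.integral_const_mul, intervalIntegral.integral_const_mul,
      intervalIntegral.integral_add k2 (j2.const_mul _),
      intervalIntegral.integral_sub k1 (j1.const_mul _),
      intervalIntegral.integral_const_mul, intervalIntegral.integral_const_mul]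
    erw [i0, i1, i2]
  have hI1 : Integrable fun x => χ x * (η x - 3 / 2 * shearMoment ω 1 s
        + 1 / 2 * (shearMoment ω 1 s - (s - 2 * Om ω 1))) :=
    (hχ.continuous.mul (by fun_prop)).integrable_of_hasCompactSupport hχc.mul_right
  have hI2 : Integrable fun x => χ x * (3 * r - 2 * η x) :=
    (hχ.continuous.mul (by fun_prop)).integrable_of_hasCompactSupport hχc.mul_right
  change ∫ x, ∫ y in (0:ℝ)..η x, T (x, y) = _
  simp_rw [hslice]
  rw [integral_add hI1 (hGI.const_mul _), integral_const_mul, hGval, ← integral_const_mul,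
    ← integral_add hI1 (hI2.const_mul _)]
  congr 1
  ext x
  linear_combination (1 / 2 * χ x) * hrc

end Sol

end

theorem exists_cutoff : ∃ B : ℝ, 0 ≤ B ∧ ∀ x0 L : ℝ, 0 < L → ∃ χ : ℝ → ℝ, ContDiff ℝ 1 χ ∧
    (∀ x, x ∉ Icc (x0 - 2 * L) (x0 + 2 * L) → χ x = 0) ∧ (∀ x, 0 ≤ χ x) ∧ (∀ x, χ x ≤ 1) ∧
    (∀ x, |x - x0| ≤ L → χ x = 1) ∧ ∀ x, deriv χ x ^ 2 ≤ B / L ^ 2 * χ x := by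
  let b : ℝ → ℝ := fun t => Real.smoothTransition (2 - t ^ 2)
  have hb : ContDiff ℝ 1 b := Real.smoothTransition.contDiff.comp
    (contDiff_const.sub (contDiff_id.pow 2))
  have hb0 : ∀ t, t ∉ Icc (-2:ℝ) 2 → b t = 0 := by
    intro t ht
    refine Real.smoothTransition.zero_of_nonpos ?_
    by_contra hlt
    exact ht ⟨by nlinarith, by nlinarith⟩
  have hb1 : ∀ t, |t| ≤ 1 → b t = 1 := fun t ht =>
    Real.smoothTransition.one_of_one_le (by nlinarith [sq_abs t, abs_nonneg t])
  obtain ⟨C, hC⟩ := (isCompact_Icc (a := (-2:ℝ)) (b := 2)).exists_bound_of_continuousOn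
    (hb.continuous_deriv le_rfl).continuousOn
  have hC' : ∀ t, deriv b t ^ 2 ≤ C ^ 2 := by
    intro t
    by_cases ht : t ∈ Icc (-2:ℝ) 2
    · rw [← sq_abs]
      exact pow_le_pow_left₀ (abs_nonneg _) (hC t ht) 2
    · rw [deriv_eq_zero_of_notMem_Icc hb0 ht]
      nlinarith [sq_nonneg C]
  refine ⟨4 * C ^ 2, by positivity, fun x0 L hL => ⟨fun x => b ((x - x0) / L) ^ 2, ?_, ?_, ?_, ?_,
    ?_, ?_⟩⟩
  · exact (hb.comp ((contDiff_id.sub contDiff_const).div_const L)).pow 2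
  · intro x hx
    have : (x - x0) / L ∉ Icc (-2:ℝ) 2 := by
      rintro ⟨h1, h2⟩
      rw [le_div_iff₀ hL] at h1
      rw [div_le_iff₀ hL] at h2
      exact hx ⟨by linarith, by linarith⟩
    simp [hb0 _ this]
  · exact fun x => sq_nonneg _
  · exact fun x => pow_le_one₀ (Real.smoothTransition.nonneg _) (Real.smoothTransition.le_one _)
  · intro x hx
    have : b ((x - x0) / L) = 1 := hb1 _ (by
      rw [abs_div, abs_of_pos hL]; exact (div_le_one hL).2 hx)
    simp [this]
  · intro x
    have h1 : HasDerivAt (fun x : ℝ => (x - x0) / L) (1 / L) x :=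
      ((hasDerivAt_id x).sub_const x0).div_const L
    have h2 : HasDerivAt (fun x => b ((x - x0) / L)) (deriv b ((x - x0) / L) * (1 / L)) x :=
      HasDerivAt.comp (h₂ := b) x (hb.differentiable one_ne_zero _).hasDerivAt h1
    have h2' : HasDerivAt (fun x => b ((x - x0) / L) ^ 2)
      (2 * b ((x - x0) / L) * (deriv b ((x - x0) / L) * (1 / L))) x :=
      (h2.pow 2).congr_deriv (by simp)
    rw [h2'.deriv]
    have h3 := hC' ((x - x0) / L)
    have h4 : 0 ≤ 4 / L ^ 2 * b ((x - x0) / L) ^ 2 := by positivity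
    calc _ = 4 / L ^ 2 * b ((x - x0) / L) ^ 2 * deriv b ((x - x0) / L) ^ 2 := by
          ring
      _ ≤ 4 / L ^ 2 * b ((x - x0) / L) ^ 2 * C ^ 2 := mul_le_mul_of_nonneg_left h3 h4
      _ = _ := by ring

/-- `∫₀^η` of the energy density at a fixed abscissa. -/
def excessSlice (ω : ℝ → ℝ) (s : ℝ) (η : ℝ → ℝ) (ψ : ℝ × ℝ → ℝ) (x : ℝ) : ℝ :=
  ∫ y in (0:ℝ)..η x, excess ω s η ψ (x, y)

section

variable {ω : ℝ → ℝ} {s lamc rc : ℝ}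

theorem exists_shear_cube_bound (hω : ContinuousOn ω (Icc 0 1)) (s : ℝ) :
    ∃ C : ℝ, 0 ≤ C ∧ ∀ p ∈ Icc (0:ℝ) 1, shear ω s p ^ 3 ≤ C := by
  obtain ⟨C, hC⟩ := (isCompact_Icc (a := (0:ℝ)) (b := 1)).exists_bound_of_continuousOn
    ((shear_continuous hω s).pow 3).continuousOn
  exact ⟨C, (norm_nonneg _).trans (hC 0 (left_mem_Icc.2 zero_le_one)),
    fun p hp => (le_abs_self _).trans (hC p hp)⟩

namespace Sol

variable {M r : ℝ} {ψ : ℝ × ℝ → ℝ} {η : ℝ → ℝ}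

theorem mem_domc_slice {x y : ℝ} (hy : y ∈ Icc 0 (η x)) : (x, y) ∈ domc η := hy

theorem excess_nonneg (h : Sol ω M r ψ η) (hω : ContinuousOn ω (Icc 0 1)) (hs : lam0 ω ^ 2 < s)
    {z : ℝ × ℝ} (hz : z ∈ domc η) : 0 ≤ excess ω s η ψ z := by
  refine le_trans ?_ (h.excess_lower hω hs hz)
  have := shear_pos hω hs (ψ z)
  have := h.unidir z hz
  positivity

theorem excessSlice_nonneg (h : Sol ω M r ψ η) (hω : ContinuousOn ω (Icc 0 1))
    (hs : lam0 ω ^ 2 < s) (x : ℝ) : 0 ≤ excessSlice ω s η ψ x :=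
  intervalIntegral.integral_nonneg (h.eta_pos x).le fun _ hy => h.excess_nonneg hω hs hy

theorem integral_py (h : Sol ω M r ψ η) (x : ℝ) : ∫ y in (0:ℝ)..η x, py η ψ (x, y) = 1 := by
  simpa using h.integral_comp_vertical (g := fun _ => 1) continuousOn_const x

theorem abs_eta_sub_le (h : Sol ω M r ψ η) (hω : ContinuousOn ω (Icc 0 1))
    (hs : lam0 ω ^ 2 < s) {κ : ℝ} (hκ : 0 < κ) (x : ℝ) :
    |η x - shearMoment ω 1 s| ≤ κ * η x + 1 / (4 * κ) * excessSlice ω s η ψ x := by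
  have i1 : ∫ y in (0:ℝ)..η x, (shear ω s (ψ (x, y)))⁻¹ ^ 1 * py η ψ (x, y)
      = shearMoment ω 1 s :=
    h.integral_comp_vertical (g := fun p => (shear ω s p)⁻¹ ^ 1)
      (shear_inv_pow_continuous hω hs 1).continuousOn x
  have j1 : IntervalIntegrable (fun y => (shear ω s (ψ (x, y)))⁻¹ ^ 1 * py η ψ (x, y))
      volume 0 (η x) :=
    h.slice_intervalIntegrable ((h.shear_continuousOn hω hs 1).mul h.py_continuousOn) x
  have j2 := h.slice_intervalIntegrable (h.excess_continuousOn hω hs) x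
  have e1 : η x - shearMoment ω 1 s
      = ∫ y in (0:ℝ)..η x, (1 - (shear ω s (ψ (x, y)))⁻¹ ^ 1 * py η ψ (x, y)) := by
    rw [intervalIntegral.integral_sub intervalIntegrable_const j1, i1]
    simp
  have e2 : κ * η x + 1 / (4 * κ) * excessSlice ω s η ψ x
      = ∫ y in (0:ℝ)..η x, (κ + 1 / (4 * κ) * excess ω s η ψ (x, y)) := by
    rw [intervalIntegral.integral_add intervalIntegrable_const (j2.const_mul _),
      intervalIntegral.integral_const_mul]
    simp [excessSlice, mul_comm]
  rw [e1, e2, ← Real.norm_eq_abs]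
  refine intervalIntegral.norm_integral_le_of_norm_le (h.eta_pos x).le ?_
    ((intervalIntegrable_const (c := κ)).add (j2.const_mul (1 / (4 * κ))))
  refine ae_of_all _ fun y hy => ?_
  have hz : (x, y) ∈ domc η := ⟨hy.1.le, hy.2⟩
  have hl := h.excess_lower hω hs hz
  have hk := shear_pos hω hs (ψ (x, y))
  have hp := h.unidir _ hz
  have hq : 0 ≤ 1 / 2 * (px η ψ (x, y) ^ 2 * py η ψ (x, y) * (shear ω s (ψ (x, y)))⁻¹ ^ 3) := by
    positivity
  have hl' := (le_add_of_nonneg_right hq).trans hl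
  rw [Real.norm_eq_abs, pow_one, mul_comm]
  set t := 1 - py η ψ (x, y) * (shear ω s (ψ (x, y)))⁻¹
  have h1 : |t| ≤ κ + 1 / (4 * κ) * t ^ 2 := by
    have e : κ + 1 / (4 * κ) * t ^ 2 - |t| = (2 * κ - |t|) ^ 2 / (4 * κ) := by
      rw [← sq_abs t]
      field_simp
      ring
    have : 0 ≤ (2 * κ - |t|) ^ 2 / (4 * κ) := by positivity
    linarith
  have h2 : 1 / (4 * κ) * t ^ 2 ≤ 1 / (4 * κ) * excess ω s η ψ (x, y) :=
    mul_le_mul_of_nonneg_left hl' (by positivity)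
  linarith

theorem excess_young (h : Sol ω M r ψ η) (hω : ContinuousOn ω (Icc 0 1)) (hc : Crit ω lamc rc)
    {B C c c' : ℝ} (hC0 : 0 ≤ C) (hC : ∀ p ∈ Icc (0:ℝ) 1, shear ω (lamc ^ 2) p ^ 3 ≤ C)
    (hB : 0 ≤ B) (hc0 : 0 ≤ c) (hc' : c' ^ 2 ≤ B * c) {z : ℝ × ℝ} (hz : z ∈ domc η) :
    1 / 2 * (c * excess ω (lamc ^ 2) η ψ z) - B * C * py η ψ z
      ≤ c * excess ω (lamc ^ 2) η ψ z
        + c' * stretch ω (lamc ^ 2) (ψ z) * px η ψ z * py η ψ z := by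
  have hs := hc.lam0_sq_lt
  have hl := h.excess_lower hω hs hz
  have hp := h.unidir z hz
  have hψ := h.mem_Icc hz
  have hk := shear_pos hω hs (ψ z)
  have hk3 := hC _ hψ
  have hΦ0 : 0 ≤ stretch ω (lamc ^ 2) (ψ z) := by
    rw [← stretch_zero ω (lamc ^ 2)]
    exact stretch_monotone hω hs hψ.1
  have hΦ1 : stretch ω (lamc ^ 2) (ψ z) ≤ 1 :=
    (stretch_monotone hω hs hψ.2).trans_eq (hc.moment_eq_one hω)
  have hK : 1 ≤ (shear ω (lamc ^ 2) (ψ z))⁻¹ ^ 3 * C := by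
    rw [inv_pow, inv_mul_eq_div, one_le_div (by positivity)]
    exact hk3
  have hl' : 1 / 2 * (px η ψ z ^ 2 * py η ψ z * (shear ω (lamc ^ 2) (ψ z))⁻¹ ^ 3)
      ≤ excess ω (lamc ^ 2) η ψ z := (le_add_of_nonneg_left (sq_nonneg _)).trans hl
  have hK0 : 0 < (shear ω (lamc ^ 2) (ψ z))⁻¹ ^ 3 := by positivity
  generalize excess ω (lamc ^ 2) η ψ z = q at *
  generalize (shear ω (lamc ^ 2) (ψ z))⁻¹ ^ 3 = K at *
  generalize stretch ω (lamc ^ 2) (ψ z) = Φ at *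
  generalize px η ψ z = u at *
  generalize py η ψ z = v at *
  have quad : 0 ≤ 1 / 4 * c * K * u ^ 2 + c' * Φ * u + B * C := by
    rcases hc0.eq_or_lt with rfl | hcp
    · have : c' = 0 := by nlinarith [sq_nonneg c']
      subst this
      nlinarith [mul_nonneg hB hC0]
    · have hd : (c' * Φ) ^ 2 ≤ c * K * (B * C) := by
        calc (c' * Φ) ^ 2 = c' ^ 2 * Φ ^ 2 := by ring
          _ ≤ c' ^ 2 * 1 := mul_le_mul_of_nonneg_left (pow_le_one₀ hΦ0 hΦ1) (sq_nonneg _)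
          _ ≤ B * c * 1 := by linarith
          _ ≤ B * c * (K * C) := mul_le_mul_of_nonneg_left hK (by positivity)
          _ = _ := by ring
      have hcK : 0 < c * K := by positivity
      refine nonneg_of_mul_nonneg_left (b := c * K) ?_ hcK
      nlinarith [sq_nonneg (1 / 2 * (c * K) * u + c' * Φ)]
  have h1 := mul_nonneg quad hp.le
  have h2 := mul_le_mul_of_nonneg_left hl' hc0
  nlinarith

theorem integral_excessSlice_le (h : Sol ω M r ψ η) (hω : ContinuousOn ω (Icc 0 1))
    (hc : Crit ω lamc rc) (hr : rc ≤ r) {B C : ℝ} (hC0 : 0 ≤ C)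
    (hC : ∀ p ∈ Icc (0:ℝ) 1, shear ω (lamc ^ 2) p ^ 3 ≤ C) (hB : 0 ≤ B) {χ : ℝ → ℝ}
    (hχ : ContDiff ℝ 1 χ) {a b : ℝ} (hab : a ≤ b) (hχs : ∀ x, x ∉ Icc a b → χ x = 0)
    (hχ0 : ∀ x, 0 ≤ χ x) (hχ1 : ∀ x, χ x ≤ 1) (hχB : ∀ x, deriv χ x ^ 2 ≤ B * χ x) :
    Integrable (fun x => χ x * excessSlice ω (lamc ^ 2) η ψ x) ∧
    ∫ x, χ x * excessSlice ω (lamc ^ 2) η ψ x ≤ (b - a) * (3 * (r - rc) + 2 * (B * C)) := by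
  have hs := hc.lam0_sq_lt
  have hex := h.excess_continuousOn hω hs
  obtain ⟨hTI, hTe⟩ := h.integral_excess hω hc hχ hχs
  have hχf : ContinuousOn (fun z : ℝ × ℝ => χ z.1) (domc η) :=
    (hχ.continuous.comp continuous_fst).continuousOn
  have hχd : ContinuousOn (fun z : ℝ × ℝ => deriv χ z.1) (domc η) :=
    ((hχ.continuous_deriv le_rfl).comp continuous_fst).continuousOn
  have hΦf : ContinuousOn (fun z => stretch ω (lamc ^ 2) (ψ z)) (domc η) :=
    (stretch_contDiff hω hs).continuous.comp_continuousOn h.continuousOn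
  obtain ⟨-, hQI, -⟩ := fubini_dom h.eta_continuous h.eta_pos
    (F := fun z => χ z.1 * excess ω (lamc ^ 2) η ψ z) (hχf.mul hex) (a := a) (b := b)
    fun z hz => by simp [hχs _ hz]
  have hQe : ∀ x, ∫ y in (0:ℝ)..η x, χ x * excess ω (lamc ^ 2) η ψ (x, y)
      = χ x * excessSlice ω (lamc ^ 2) η ψ x := fun x =>
    intervalIntegral.integral_const_mul _ _
  have hQI' : Integrable (fun x => χ x * excessSlice ω (lamc ^ 2) η ψ x) :=
    hQI.congr (ae_of_all _ fun x => hQe x)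
  refine ⟨hQI', ?_⟩
  have hind : Integrable ((Icc a b).indicator fun _ : ℝ => B * C) :=
    (integrable_indicator_iff measurableSet_Icc).2 continuousOn_const.integrableOn_Icc
  have hpt : ∀ x, 1 / 2 * (χ x * excessSlice ω (lamc ^ 2) η ψ x)
      ≤ (∫ y in (0:ℝ)..η x, (χ x * excess ω (lamc ^ 2) η ψ (x, y)
        + deriv χ x * stretch ω (lamc ^ 2) (ψ (x, y)) * px η ψ (x, y) * py η ψ (x, y)))
        + (Icc a b).indicator (fun _ => B * C) x := by
    intro x
    by_cases hx : x ∈ Icc a b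
    · rw [indicator_of_mem hx]
      have j1 : IntervalIntegrable (fun y => 1 / 2 * (χ x * excess ω (lamc ^ 2) η ψ (x, y)))
          volume 0 (η x) := ((h.slice_intervalIntegrable hex x).const_mul _).const_mul _
      have j2 : IntervalIntegrable (fun y => B * C * py η ψ (x, y)) volume 0 (η x) :=
        (h.slice_intervalIntegrable h.py_continuousOn x).const_mul _
      have j3 : IntervalIntegrable (fun y => χ x * excess ω (lamc ^ 2) η ψ (x, y)
          + deriv χ x * stretch ω (lamc ^ 2) (ψ (x, y)) * px η ψ (x, y) * py η ψ (x, y))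
          volume 0 (η x) :=
        h.slice_intervalIntegrable ((hχf.mul hex).add
          (((hχd.mul hΦf).mul h.px_continuousOn).mul h.py_continuousOn)) x
      have := intervalIntegral.integral_mono_on (h.eta_pos x).le (j1.sub j2) j3 fun y hy =>
        h.excess_young hω hc hC0 hC hB (hχ0 x) (hχB x) (mem_domc_slice hy)
      rw [intervalIntegral.integral_sub j1 j2, intervalIntegral.integral_const_mul,
        intervalIntegral.integral_const_mul, intervalIntegral.integral_const_mul,
        h.integral_py] at this
      change _ ≤ _ at this
      unfold excessSlice
      linarith
    · simp [hχs x hx, deriv_eq_zero_of_notMem_Icc hχs hx, hx]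
  have hmono := integral_mono (hQI'.const_mul (1 / 2)) (hTI.add hind) hpt
  have hval : ∫ x, (Icc a b).indicator (fun _ : ℝ => B * C) x = (b - a) * (B * C) := by
    rw [integral_indicator_const _ measurableSet_Icc]
    simp [Measure.real, hab]
  have hχi : ∫ x, χ x ≤ b - a := by
    have hi : Integrable ((Icc a b).indicator fun _ : ℝ => (1:ℝ)) :=
      (integrable_indicator_iff measurableSet_Icc).2 continuousOn_const.integrableOn_Icc
    calc ∫ x, χ x ≤ ∫ x, (Icc a b).indicator (fun _ : ℝ => (1:ℝ)) x := by
          refine integral_mono_of_nonneg (ae_of_all _ hχ0) hi (ae_of_all _ fun x => ?_)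
          by_cases hx : x ∈ Icc a b
          · simpa [hx] using hχ1 x
          · simp [hx, hχs x hx]
      _ = b - a := by
          rw [integral_indicator_const _ measurableSet_Icc]
          simp [Measure.real, hab]
  erw [integral_const_mul, integral_add hTI hind] at hmono
  rw [hTe, hval, integral_mul_const] at hmono
  have := mul_le_mul_of_nonneg_right hχi (show 0 ≤ 3 / 2 * (r - rc) by linarith)
  linarith

end Sol

theorem exists_profile_close (hω : ContinuousOn ω (Icc 0 1)) (hc : Crit ω lamc rc) {M : ℝ}
    (hM : 0 < M) {ε : ℝ} (hε : 0 < ε) :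
    ∃ r₁, rc < r₁ ∧ ∀ r, rc < r → r ≤ r₁ → ∀ (ψ : ℝ × ℝ → ℝ) (η : ℝ → ℝ), Sol ω M r ψ η →
      ∀ x, |η x - dep ω lamc| < ε := by
  obtain ⟨B, hB, hcut⟩ := exists_cutoff
  obtain ⟨C, hC0, hC⟩ := exists_shear_cube_bound hω (lamc ^ 2)
  have hs := hc.lam0_sq_lt
  set H := 3 / 2 * (|rc| + 1) with hH
  have hHp : 0 < H := by positivity
  set κ := ε / (4 * H) with hκ
  have hκp : 0 < κ := by positivity
  set ρ := ε / (2 * M) with hρ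
  have hρp : 0 < ρ := by positivity
  set σ := κ * ε with hσ
  have hσp : 0 < σ := by positivity
  set L := ρ + 16 * (B * C) / (ρ * σ) with hL
  have hLρ : ρ ≤ L := le_add_of_nonneg_right (by positivity)
  have hLp : 0 < L := hρp.trans_le hLρ
  have hLBC : 8 * (B * C) / L ≤ ρ * σ / 2 := by
    rw [div_le_iff₀ hLp]
    have : ρ * σ / 2 * L = ρ * σ / 2 * ρ + 8 * (B * C) := by
      rw [hL]; field_simp; ring
    have : 0 ≤ ρ * σ / 2 * ρ := by positivity
    linarith
  refine ⟨rc + min 1 (ρ * σ / (12 * L)), lt_add_of_pos_right _ (by positivity), ?_⟩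
  intro r hr hr' ψ η h x0
  have hr1 : r - rc ≤ 1 := by linarith [min_le_left 1 (ρ * σ / (12 * L))]
  have hr2 : r - rc ≤ ρ * σ / (12 * L) := by linarith [min_le_right 1 (ρ * σ / (12 * L))]
  rw [le_div_iff₀ (by positivity)] at hr2
  by_contra! hfar
  have hηH : ∀ x, κ * η x ≤ ε / 4 := by
    intro x
    have h1 : η x ≤ H := by
      have := h.eta_lt x
      have := le_abs_self rc
      rw [hH]; linarith
    calc κ * η x ≤ κ * H := mul_le_mul_of_nonneg_left h1 hκp.le
      _ = ε / 4 := by rw [hκ]; field_simp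
  have hQ : ∀ x, |x - x0| ≤ ρ → σ ≤ excessSlice ω (lamc ^ 2) η ψ x := by
    intro x hx
    have hlip := h.eta_lip.dist_le_mul x x0
    rw [Real.dist_eq, Real.dist_eq, Real.coe_toNNReal M hM.le] at hlip
    have h1 : M * |x - x0| ≤ ε / 2 :=
      (mul_le_mul_of_nonneg_left hx hM.le).trans_eq (by rw [hρ]; field_simp)
    have h2 : ε / 2 ≤ |η x - dep ω lamc| := by
      have := abs_sub_le (η x0) (η x) (dep ω lamc)
      rw [abs_sub_comm (η x0) (η x)] at this
      linarith
    have h3 := h.abs_eta_sub_le hω hs hκp x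
    rw [← dep_eq_shearMoment] at h3
    have h4 : ε / 4 ≤ 1 / (4 * κ) * excessSlice ω (lamc ^ 2) η ψ x := by
      linarith [hηH x]
    rw [one_div_mul_eq_div, le_div_iff₀ (by positivity)] at h4
    rw [hσ]; linarith
  obtain ⟨χ, hχ, hχs, hχ0, hχ1, hχe, hχB⟩ := hcut x0 L hLp
  obtain ⟨hI, hle⟩ := h.integral_excessSlice_le hω hc hr.le hC0 hC
    (show 0 ≤ B / L ^ 2 by positivity) hχ (by linarith) hχs hχ0 hχ1 hχB
  have hlow : 2 * ρ * σ ≤ ∫ x, χ x * excessSlice ω (lamc ^ 2) η ψ x := by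
    calc 2 * ρ * σ = ∫ x, (Icc (x0 - ρ) (x0 + ρ)).indicator (fun _ : ℝ => σ) x := by
          rw [integral_indicator_const _ measurableSet_Icc]
          simp only [Measure.real, Real.volume_Icc, smul_eq_mul]
          rw [ENNReal.toReal_ofReal (by linarith)]
          ring
      _ ≤ _ := by
          refine integral_mono ((integrable_indicator_iff measurableSet_Icc).2
            continuousOn_const.integrableOn_Icc) hI fun x => ?_
          by_cases hx : x ∈ Icc (x0 - ρ) (x0 + ρ)
          · have hx' : |x - x0| ≤ ρ := abs_le.2 ⟨by linarith [hx.1], by linarith [hx.2]⟩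
            simpa [hx, hχe x (hx'.trans hLρ)] using hQ x hx'
          · simpa [hx] using mul_nonneg (hχ0 x) (h.excessSlice_nonneg hω hs x)
  have e : (x0 + 2 * L - (x0 - 2 * L)) * (3 * (r - rc) + 2 * (B / L ^ 2 * C))
      = (r - rc) * (12 * L) + 8 * (B * C) / L := by
    field_simp
    ring
  rw [e] at hle
  have : 0 < ρ * σ := by positivity
  linarith

end

/-- Theorem 4.2(a) (nearcritical profiles are uniformly close to d₊(r)). -/
theorem statement7
    (ω : ℝ → ℝ) (K : NNReal) (hω : LipschitzOnWith K ω (Icc (0:ℝ) 1))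
    (lamc rc : ℝ) (hc : Crit ω lamc rc) :
    ∀ M : ℝ, 0 < M → ∀ ε : ℝ, 0 < ε →
      ∃ r' : ℝ, rc < r' ∧
        ∀ r : ℝ, rc < r → r ≤ r' → r ≤ RR ω ((lamc + lam0 ω) / 2) →
          ∀ (ψ : ℝ × ℝ → ℝ) (η : ℝ → ℝ), Sol ω M r ψ η →
            ∀ lamp : ℝ, lam0 ω < lamp → lamp < lamc → RR ω lamp = r →
              ∀ x : ℝ, |η x - dep ω lamp| < ε := by
  intro M hM ε hε
  obtain ⟨r₁, hr₁, hprofile⟩ := exists_profile_close hω.continuousOn hc hM (half_pos hε)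
  obtain ⟨r₂, hr₂, hdepth⟩ := hc.exists_depth_close hω.continuousOn (half_pos hε)
  refine ⟨min r₁ ((rc + r₂) / 2), lt_min hr₁ (by linarith), ?_⟩
  intro r hr hr' _ ψ η h lamp h0 hlt hR x
  have h1 := hprofile r hr (hr'.trans (min_le_left _ _)) ψ η h x
  have h2 := hdepth lamp h0 hlt (by linarith [hr'.trans (min_le_right r₁ ((rc + r₂) / 2))])
  have h3 := abs_sub_le (η x) (dep ω lamc) (dep ω lamp)
  rw [abs_sub_comm (dep ω lamc)] at h3
  linarith

end BL
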